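/- arXiv:2511.14091 — 2 statements merged into one kernel-verified Lean document; each statement's English description precedes it below -/
import Mathlib

section
/- Let (Ω, F, P) be a probability space, Θ and Y integrable real-valued random variables, W a random variable with values in a standard Borel space E, and m : ℝ → ℝ a Borel measurable function with m(Θ) integrable. Then the following are equivalent: (i) there exist a probability space (Ω*, F*, P*) and random variables Θ*, Y* (real-valued) and W* (E-valued) on it such that (Θ*, W*) has the same joint distribution as (Θ, W), (Y*, W*) has the same joint distribution as (Y, W), and E[Y* | σ(Θ*) ⊔ σ(W*)] = m(Θ*) P*-almost surely; (ii) E[m(Θ) | σ(W)] = E[Y | σ(W)] almost surely and, for every convex function φ : ℝ → ℝ such that φ(m(Θ)) and φ(Y) are integrable, E[φ(m(Θ)) | σ(W)] ≤ E[φ(Y) | σ(W)] almost surely. -/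
open MeasureTheory

noncomputable def mPhi {n : ℕ} (c : Fin (n+1) → ℝ × ℝ) (x : ℝ) : ℝ :=
  Finset.univ.sup' Finset.univ_nonempty (fun i => (c i).1 * x + (c i).2)

lemma mPhi_cont {n : ℕ} : Continuous (fun p : (Fin (n+1) → ℝ × ℝ) × ℝ => mPhi p.1 p.2) := by
  unfold mPhi
  apply Continuous.finset_sup'_apply
  intro i _
  fun_prop

lemma mPhi_tendsto {n : ℕ} {u : ℕ → Fin (n+1) → ℝ × ℝ} {c : Fin (n+1) → ℝ × ℝ}
    (h : Filter.Tendsto u Filter.atTop (nhds c)) (x : ℝ) :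
    Filter.Tendsto (fun k => mPhi (u k) x) Filter.atTop (nhds (mPhi c x)) := by
  have h0 : Continuous (fun c : Fin (n+1) → ℝ × ℝ => mPhi c x) :=
    mPhi_cont.comp (Continuous.prodMk continuous_id continuous_const)
  exact (h0.tendsto c).comp h

lemma mPhi_bound {n : ℕ} (c : Fin (n+1) → ℝ × ℝ) (x : ℝ) : |mPhi c x| ≤ ‖c‖ * (1 + |x|) := by
  have key : ∀ i, |(c i).1 * x + (c i).2| ≤ ‖c‖ * (1 + |x|) := by
    intro i
    have h0 := norm_le_pi_norm c i
    have h1 : |(c i).1| ≤ ‖c‖ := (norm_fst_le (c i)).trans h0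
    have h2 : |(c i).2| ≤ ‖c‖ := (norm_snd_le (c i)).trans h0
    calc _ ≤ |(c i).1 * x| + |(c i).2| := abs_add_le _ _
      _ = |(c i).1| * |x| + |(c i).2| := by rw [abs_mul]
      _ ≤ ‖c‖ * |x| + ‖c‖ := by gcongr
      _ = _ := by ring
  unfold mPhi
  rw [abs_le]
  constructor
  · exact (abs_le.1 (key 0)).1.trans (Finset.le_sup' (fun i => (c i).1 * x + (c i).2) (Finset.mem_univ 0))
  · exact Finset.sup'_le _ _ (fun i _ => (abs_le.1 (key i)).2)

lemma mPhi_convex {n : ℕ} (c : Fin (n+1) → ℝ × ℝ) : ConvexOn ℝ Set.univ (mPhi c) := by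
  refine ⟨convex_univ, ?_⟩
  intro x _ y _ a b ha hb hab
  unfold mPhi
  refine Finset.sup'_le _ _ (fun i _ => ?_)
  have h1 := Finset.le_sup' (fun i => (c i).1 * x + (c i).2) (Finset.mem_univ i)
  have h2 := Finset.le_sup' (fun i => (c i).1 * y + (c i).2) (Finset.mem_univ i)
  simp only [smul_eq_mul] at *
  have h1' := mul_le_mul_of_nonneg_left h1 ha
  have h2' := mul_le_mul_of_nonneg_left h2 hb
  have e : (c i).1 * (a * x + b * y) + (c i).2
    = a * ((c i).1 * x + (c i).2) + b * ((c i).1 * y + (c i).2) := by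
    have : (c i).2 = (a + b) * (c i).2 := by rw [hab, one_mul]
    nth_rewrite 1 [this]; ring
  rw [e]; linarith

def CxH {Ω : Type*} [MeasurableSpace Ω] (P : Measure Ω) (X Y V : Ω → ℝ) : Prop :=
  ∀ φ : ℝ → ℝ, ConvexOn ℝ Set.univ φ → Integrable (fun ω => φ (X ω)) P →
    Integrable (fun ω => φ (Y ω)) P → ∀ A : Set ℝ, MeasurableSet A →
    ∫ ω in V ⁻¹' A, φ (X ω) ∂P ≤ ∫ ω in V ⁻¹' A, φ (Y ω) ∂P

section
variable {Ω : Type*} [MeasurableSpace Ω] {P : Measure Ω} [IsProbabilityMeasure P]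
  {X Y V : Ω → ℝ}

lemma mPhi_int {n : ℕ} (hX : Measurable X) (hV : Measurable V) (hXi : Integrable X P)
    (c : ℝ → Fin (n+1) → ℝ × ℝ) (hc : Measurable c) (C : ℝ) (hC : ∀ w, ‖c w‖ ≤ C) :
    Integrable (fun ω => mPhi (c (V ω)) (X ω)) P := by
  refine Integrable.mono' (g := fun ω => C * (1 + |X ω|)) (((integrable_const 1).add hXi.abs).const_mul C) ?_ ?_
  · exact (mPhi_cont.measurable.comp ((hc.comp hV).prodMk hX)).aestronglyMeasurable
  · refine Filter.Eventually.of_forall fun ω => (mPhi_bound _ _).trans ?_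
    gcongr
    exact hC _

lemma simple_split {n : ℕ} (hX : Measurable X) (hV : Measurable V) (hXi : Integrable X P)
    (s : SimpleFunc ℝ (Fin (n+1) → ℝ × ℝ)) :
    ∫ ω, mPhi (s (V ω)) (X ω) ∂P = ∑ c ∈ s.range, ∫ ω in V ⁻¹' (s ⁻¹' {c}), mPhi c (X ω) ∂P := by
  have hi : ∀ c : Fin (n+1) → ℝ × ℝ, Integrable (fun ω => mPhi c (X ω)) P := fun c =>
    mPhi_int hX hV hXi (fun _ => c) measurable_const ‖c‖ (fun _ => le_rfl)
  have hm : ∀ c, MeasurableSet (V ⁻¹' (s ⁻¹' {c})) := fun c => hV (s.measurableSet_preimage _)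
  simp_rw [← integral_indicator (hm _)]
  rw [← integral_finsetSum _ (fun c _ => (hi c).indicator (hm c))]
  congr 1
  ext ω
  rw [Finset.sum_eq_single (s (V ω))]
  · simp
  · intro b _ hb
    simp [hb.symm]
  · intro h
    exact absurd (SimpleFunc.mem_range_self s (V ω)) h

lemma lemA {n : ℕ} (hX : Measurable X) (hY : Measurable Y) (hV : Measurable V)
    (hXi : Integrable X P) (hYi : Integrable Y P) (H : CxH P X Y V)
    (c : ℝ → Fin (n+1) → ℝ × ℝ) (hc : Measurable c) (C : ℝ) (hC : ∀ w, ‖c w‖ ≤ C) :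
    ∫ ω, mPhi (c (V ω)) (X ω) ∂P ≤ ∫ ω, mPhi (c (V ω)) (Y ω) ∂P := by
  have hsm := hc.stronglyMeasurable
  have hC0 : 0 ≤ C := (norm_nonneg _).trans (hC 0)
  obtain ⟨s, hs, hlim⟩ : ∃ s : ℕ → SimpleFunc ℝ (Fin (n+1) → ℝ × ℝ), (∀ k w, ‖s k w‖ ≤ C) ∧
      ∀ w, Filter.Tendsto (fun k => s k w) Filter.atTop (nhds (c w)) :=
    ⟨fun k => hsm.approxBounded C k, fun k w => hsm.norm_approxBounded_le hC0 k w,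
      fun w => hsm.tendsto_approxBounded_of_norm_le (hC w)⟩
  have lim : ∀ {Z : Ω → ℝ}, Measurable Z → Integrable Z P →
      Filter.Tendsto (fun k => ∫ ω, mPhi (s k (V ω)) (Z ω) ∂P) Filter.atTop
        (nhds (∫ ω, mPhi (c (V ω)) (Z ω) ∂P)) := by
    intro Z hZ hZi
    refine tendsto_integral_of_dominated_convergence (fun ω => C * (1 + |Z ω|)) ?_
      (((integrable_const 1).add hZi.abs).const_mul C) ?_ ?_
    · intro k
      exact (mPhi_int hZ hV hZi _ (s k).measurable C (hs k)).aestronglyMeasurable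
    · intro k
      refine Filter.Eventually.of_forall fun ω => (mPhi_bound _ _).trans ?_
      gcongr
      exact hs k _
    · refine Filter.Eventually.of_forall fun ω => ?_
      exact mPhi_tendsto (hlim (V ω)) (Z ω)
  refine le_of_tendsto_of_tendsto' (lim hX hXi) (lim hY hYi) (fun k => ?_)
  rw [simple_split hX hV hXi, simple_split hY hV hYi]
  refine Finset.sum_le_sum fun c _ => H _ (mPhi_convex c) ?_ ?_ _ ((s k).measurableSet_preimage _)
  · exact mPhi_int hX hV hXi (fun _ => c) measurable_const ‖c‖ (fun _ => le_rfl)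
  · exact mPhi_int hY hV hYi (fun _ => c) measurable_const ‖c‖ (fun _ => le_rfl)

/-- positivity of the dual functional -/
lemma dual_pos (hX : Measurable X) (hY : Measurable Y) (hV : Measurable V)
    (hXi : Integrable X P) (hYi : Integrable Y P) (H : CxH P X Y V)
    (F G k : ℝ × ℝ → ℝ) (hF : Continuous F) (hk : Continuous k)
    (C : ℝ) (hFb : ∀ x w, |F (x, w)| ≤ C * (1 + |x|)) (hkb : ∀ p, |k p| ≤ C)
    (hFi : Integrable (fun ω => F (X ω, V ω)) P) (hGi : Integrable (fun ω => G (Y ω, V ω)) P)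
    (hpos : ∀ x w y, 0 ≤ F (x, w) + G (y, w) + k (x, w) * (y - x)) :
    0 ≤ ∫ ω, F (X ω, V ω) ∂P + ∫ ω, G (Y ω, V ω) ∂P := by
  let q := TopologicalSpace.denseSeq ℝ
  let c : (n : ℕ) → ℝ → Fin (n+1) → ℝ × ℝ := fun n w i =>
    (- k (q i, w), - F (q i, w) + k (q i, w) * q i)
  have hcc : ∀ n, Continuous (c n) := by
    intro n; simp only [c]; fun_prop
  have hcb : ∀ n, ∃ D, ∀ w, ‖c n w‖ ≤ D := by
    intro n
    have hC0 : 0 ≤ C := (abs_nonneg _).trans (hkb (0,0))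
    refine ⟨∑ i : Fin (n+1), (C + C * (1 + |q i|) + C * |q i|), fun w => ?_⟩
    have hnn : ∀ i : Fin (n+1), 0 ≤ (C + C * (1 + |q i|) + C * |q i|) := fun i => by positivity
    refine (pi_norm_le_iff_of_nonneg (Finset.sum_nonneg fun i _ => hnn i)).2 fun i => ?_
    refine le_trans ?_ (Finset.single_le_sum (fun i _ => hnn i) (Finset.mem_univ i))
    rw [Prod.norm_def, Real.norm_eq_abs, Real.norm_eq_abs]
    have h1 := hkb (q i, w)
    have h2 := hFb (q i) w
    have h3 : |k (q i, w) * q i| ≤ C * |q i| := by rw [abs_mul]; gcongr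
    have h4 := abs_add_le (- F (q i, w)) (k (q i, w) * q i)
    rw [abs_neg] at h4
    have h5 : 0 ≤ C * (1 + |q i|) := by positivity
    have h6 : 0 ≤ C * |q i| := by positivity
    refine max_le ?_ ?_
    · simp only [c, abs_neg]; linarith
    · simp only [c]; linarith
  have hint : ∀ n {Z : Ω → ℝ}, Measurable Z → Integrable Z P →
      Integrable (fun ω => mPhi (c n (V ω)) (Z ω)) P := by
    intro n Z hZ hZi
    obtain ⟨D, hD⟩ := hcb n
    exact mPhi_int hZ hV hZi _ (hcc n).measurable D hD
  have hineq : ∀ n, ∫ ω, mPhi (c n (V ω)) (X ω) ∂P ≤ ∫ ω, G (Y ω, V ω) ∂P := by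
    intro n
    obtain ⟨D, hD⟩ := hcb n
    refine (lemA hX hY hV hXi hYi H _ (hcc n).measurable D hD).trans ?_
    refine integral_mono (hint n hY hYi) hGi fun ω => ?_
    refine Finset.sup'_le _ _ fun i _ => ?_
    have := hpos (q i) (V ω) (Y ω)
    simp only [c]
    linarith
  have hge : ∀ n (i : ℕ), i ≤ n → ∀ x w, - F (q i, w) - k (q i, w) * (x - q i) ≤ mPhi (c n w) x := by
    intro n i hi x w
    refine le_trans (le_of_eq ?_) (Finset.le_sup' (fun j => (c n w j).1 * x + (c n w j).2)
      (Finset.mem_univ (⟨i, by omega⟩ : Fin (n+1))))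
    simp only [c]; ring
  have hlim : Filter.Tendsto (fun n => ∫ ω, min (mPhi (c n (V ω)) (X ω)) (- F (X ω, V ω)) ∂P)
      Filter.atTop (nhds (∫ ω, - F (X ω, V ω) ∂P)) := by
    refine tendsto_integral_of_dominated_convergence
      (fun ω => |mPhi (c 0 (V ω)) (X ω)| + |F (X ω, V ω)|) ?_
      ((hint 0 hX hXi).abs.add hFi.abs) ?_ ?_
    · intro n
      exact ((hint n hX hXi).inf hFi.neg).aestronglyMeasurable
    · intro n
      refine Filter.Eventually.of_forall fun ω => ?_
      have h0 : mPhi (c 0 (V ω)) (X ω) ≤ mPhi (c n (V ω)) (X ω) := by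
        refine Finset.sup'_le _ _ fun i _ => le_trans (le_of_eq ?_) (hge n i (by omega) (X ω) (V ω))
        simp only [c]; ring
      rw [Real.norm_eq_abs, abs_le]
      constructor
      · refine le_min ?_ ?_
        · have := neg_abs_le (mPhi (c 0 (V ω)) (X ω)); have := abs_nonneg (F (X ω, V ω)); linarith
        · have := le_abs_self (F (X ω, V ω)); have := abs_nonneg (mPhi (c 0 (V ω)) (X ω)); linarith
      · refine (min_le_right _ _).trans ?_
        have := neg_abs_le (F (X ω, V ω)); have := abs_nonneg (mPhi (c 0 (V ω)) (X ω)); linarith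
    · refine Filter.Eventually.of_forall fun ω => ?_
      rw [tendsto_order]
      constructor
      · intro a ha
        have hcont : Continuous fun t => - F (t, V ω) - k (t, V ω) * (X ω - t) := by fun_prop
        have hop : IsOpen {t | a < - F (t, V ω) - k (t, V ω) * (X ω - t)} :=
          isOpen_lt continuous_const hcont
        obtain ⟨i, hi⟩ := (TopologicalSpace.denseRange_denseSeq ℝ).exists_mem_open hop
          ⟨X ω, by simpa using ha⟩
        filter_upwards [Filter.eventually_ge_atTop i] with n hn
        exact lt_min (lt_of_lt_of_le hi (hge n i hn _ _)) ha
      · intro a ha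
        exact Filter.Eventually.of_forall fun n => lt_of_le_of_lt (min_le_right _ _) ha
  have := le_of_tendsto' hlim (fun n => (integral_mono ((hint n hX hXi).inf hFi.neg) (hint n hX hXi)
    (fun ω => min_le_left _ _)).trans (hineq n))
  rw [integral_neg] at this
  linarith
end

open scoped BoundedContinuousFunction in
lemma ext_lemma {Ω : Type*} [MeasurableSpace Ω] {P : Measure Ω} [IsProbabilityMeasure P]
    {X Y V : Ω → ℝ} (hX : Measurable X) (hY : Measurable Y) (hV : Measurable V)
    (hXi : Integrable X P) (hYi : Integrable Y P) (H : CxH P X Y V) :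
    ∃ Λ : (((ℝ × ℝ) × ℝ) →ᵇ ℝ) →ₗ[ℝ] ℝ, ∀ (f g k : (ℝ × ℝ) →ᵇ ℝ) (h : ((ℝ × ℝ) × ℝ) →ᵇ ℝ),
      (∀ x w y : ℝ, (1 + |x| + |y|) * h ((x, w), y) ≤
        (1 + |x|) * f (x, w) + (1 + |y|) * g (y, w) + k (x, w) * (y - x)) →
      Λ h ≤ ∫ ω, (1 + |X ω|) * f (X ω, V ω) ∂P + ∫ ω, (1 + |Y ω|) * g (Y ω, V ω) ∂P := by
  have hint : ∀ {Z : Ω → ℝ}, Measurable Z → Integrable Z P → ∀ f : (ℝ × ℝ) →ᵇ ℝ,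
      Integrable (fun ω => (1 + |Z ω|) * f (Z ω, V ω)) P := by
    intro Z hZ hZi f
    refine Integrable.mul_bdd (c := ‖f‖) ((integrable_const 1).add hZi.abs) ?_ ?_
    · exact (f.continuous.measurable.comp (hZ.prodMk hV)).aestronglyMeasurable
    · exact Filter.Eventually.of_forall fun ω => f.norm_coe_le_norm _
  let A : (((ℝ × ℝ) →ᵇ ℝ) × ((ℝ × ℝ) →ᵇ ℝ) × ((ℝ × ℝ) →ᵇ ℝ)) × (((ℝ × ℝ) × ℝ) →ᵇ ℝ) → ℝ → ℝ → ℝ → ℝ := fun t x w y =>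
    (1 + |x|) * t.1.1 (x, w) + (1 + |y|) * t.1.2.1 (y, w) + t.1.2.2 (x, w) * (y - x)
      - (1 + |x| + |y|) * t.2 ((x, w), y)
  let L : (((ℝ × ℝ) →ᵇ ℝ) × ((ℝ × ℝ) →ᵇ ℝ) × ((ℝ × ℝ) →ᵇ ℝ)) →ₗ[ℝ] ℝ :=
    { toFun := fun t => ∫ ω, (1 + |X ω|) * t.1 (X ω, V ω) ∂P + ∫ ω, (1 + |Y ω|) * t.2.1 (Y ω, V ω) ∂P
      map_add' := by
        intro s t
        simp only [Prod.fst_add, Prod.snd_add, BoundedContinuousFunction.add_apply, mul_add]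
        rw [integral_add (hint hX hXi _) (hint hX hXi _), integral_add (hint hY hYi _) (hint hY hYi _)]
        ring
      map_smul' := by
        intro a t
        simp only [Prod.smul_fst, Prod.smul_snd, BoundedContinuousFunction.coe_smul, smul_eq_mul,
          RingHom.id_apply, mul_left_comm _ a]
        rw [integral_const_mul, integral_const_mul]; ring }
  let s : PointedCone ℝ ((((ℝ × ℝ) →ᵇ ℝ) × ((ℝ × ℝ) →ᵇ ℝ) × ((ℝ × ℝ) →ᵇ ℝ)) × (((ℝ × ℝ) × ℝ) →ᵇ ℝ)) :=
    { carrier := {t | ∀ x w y, 0 ≤ A t x w y}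
      add_mem' := by
        intro a b ha hb x w y
        have := ha x w y
        have := hb x w y
        have e : A (a + b) x w y = A a x w y + A b x w y := by simp [A]; ring
        rw [e]; linarith
      zero_mem' := by intro x w y; simp [A]
      smul_mem' := by
        intro c a ha x w y
        have e : A (c • a) x w y = c * A a x w y := by
          have e0 : c • a = (c : ℝ) • a := rfl
          have e1 : ∀ r : ℝ, A (r • a) x w y = r * A a x w y := by
            intro r; simp [A]; ring
          rw [e0]; exact e1 c
        rw [e]; exact mul_nonneg c.2 (ha x w y) }
  let f : ((((ℝ × ℝ) →ᵇ ℝ) × ((ℝ × ℝ) →ᵇ ℝ) × ((ℝ × ℝ) →ᵇ ℝ)) × (((ℝ × ℝ) × ℝ) →ᵇ ℝ)) →ₗ.[ℝ] ℝ :=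
    { domain := Submodule.prod ⊤ ⊥
      toFun := L ∘ₗ (LinearMap.fst ℝ _ _) ∘ₗ (Submodule.subtype _) }
  obtain ⟨g, hg1, hg2⟩ := riesz_extension s f (by
    rintro ⟨⟨⟨a, b, k⟩, h⟩, hh⟩ hs
    have hh0 : h = 0 := hh.2
    subst hh0
    change 0 ≤ ∫ ω, (1 + |X ω|) * a (X ω, V ω) ∂P + ∫ ω, (1 + |Y ω|) * b (Y ω, V ω) ∂P
    have ha : Continuous a := a.continuous
    refine dual_pos hX hY hV hXi hYi H (fun p => (1 + |p.1|) * a p) (fun p => (1 + |p.1|) * b p) k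
      (by fun_prop) k.continuous (max ‖a‖ ‖k‖) ?_ ?_ (hint hX hXi a) (hint hY hYi b) ?_
    · intro x w
      rw [abs_mul, abs_of_nonneg (by positivity : 0 ≤ 1 + |x|), mul_comm]
      gcongr
      exact (a.norm_coe_le_norm _).trans (le_max_left _ _)
    · intro p
      exact (k.norm_coe_le_norm _).trans (le_max_right _ _)
    · intro x w y
      have := hs x w y
      simpa [A] using this) (by
    rintro ⟨⟨a, b, k⟩, h⟩
    refine ⟨⟨((BoundedContinuousFunction.const _ ‖h‖ - a, BoundedContinuousFunction.const _ ‖h‖ - b, - k), 0), ?_⟩, ?_⟩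
    · exact ⟨trivial, rfl⟩
    · intro x w y
      simp only [A]
      simp
      have h1 : h ((x,w),y) ≤ ‖h‖ := (le_abs_self _).trans (h.norm_coe_le_norm _)
      have h2 : 0 ≤ ‖h‖ := norm_nonneg _
      have h3 : (1 + |x| + |y|) * h ((x,w),y) ≤ (1 + |x| + |y|) * ‖h‖ := by gcongr
      nlinarith)
  refine ⟨-(g ∘ₗ LinearMap.inr ℝ _ _), ?_⟩
  intro a b k h hle
  have h1 := hg1 ⟨((a, b, k), 0), ⟨trivial, rfl⟩⟩
  change g ((a, b, k), 0) = ∫ ω, (1 + |X ω|) * a (X ω, V ω) ∂P + ∫ ω, (1 + |Y ω|) * b (Y ω, V ω) ∂P at h1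
  have h2 := hg2 ((a, b, k), h) (by
    intro x w y
    simp only [A]
    linarith [hle x w y])
  have h3 : g ((a, b, k), h) = g ((a, b, k), 0) + g (0, h) := by
    rw [← map_add]; simp
  rw [← h1]
  simp only [LinearMap.neg_apply, LinearMap.comp_apply, LinearMap.inr_apply]
  linarith

open scoped BoundedContinuousFunction CompactlySupported in
lemma rmk_lemma {Z : Type*} [TopologicalSpace Z] [T2Space Z] [LocallyCompactSpace Z]
    [MeasurableSpace Z] [BorelSpace Z] (Λ : (Z →ᵇ ℝ) →ₗ[ℝ] ℝ)
    (hΛ : ∀ h : Z →ᵇ ℝ, (∀ z, 0 ≤ h z) → 0 ≤ Λ h)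
    (χ : ℕ → C_c(Z, ℝ)) (h0 : ∀ n z, 0 ≤ χ n z) (h1 : ∀ n z, χ n z ≤ 1)
    (hlim : ∀ z, Filter.Tendsto (fun n => χ n z) Filter.atTop (nhds 1))
    (ht : Filter.Tendsto (fun n => Λ (1 - (χ n).toBoundedContinuousFunction)) Filter.atTop (nhds 0)) :
    ∃ μ : Measure Z, IsFiniteMeasure μ ∧ ∀ h : Z →ᵇ ℝ, ∫ z, h z ∂μ = Λ h := by
  have mono : ∀ a b : Z →ᵇ ℝ, (∀ z, a z ≤ b z) → Λ a ≤ Λ b := by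
    intro a b hab
    have := hΛ (b - a) (fun z => by simpa using hab z)
    rw [map_sub] at this; linarith
  let Λ₀ : C_c(Z, ℝ) →ₗ[ℝ] ℝ :=
    { toFun := fun f => Λ f.toBoundedContinuousFunction
      map_add' := by
        intro a b; rw [← map_add]; rfl
      map_smul' := by
        intro c a; rw [← map_smul]; rfl }
  let Λc : C_c(Z, ℝ) →ₚ[ℝ] ℝ := PositiveLinearMap.mk₀ Λ₀ (fun f hf => hΛ _ hf)
  have hμ := RealRMK.integral_rieszMeasure Λc
  have hΛc : ∀ f : C_c(Z, ℝ), Λc f = Λ f.toBoundedContinuousFunction := fun f => rfl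
  set μ := RealRMK.rieszMeasure Λc
  have hfin : IsFiniteMeasure μ := by
    refine ⟨?_⟩
    have hb : ∀ n, ∫⁻ z, ENNReal.ofReal (χ n z) ∂μ ≤ ENNReal.ofReal (Λ 1) := by
      intro n
      rw [← ofReal_integral_eq_lintegral_ofReal
        (f := fun z => χ n z)
        ((χ n).continuous.integrable_of_hasCompactSupport (χ n).hasCompactSupport)
        (Filter.Eventually.of_forall (h0 n)), hμ, hΛc]
      exact ENNReal.ofReal_le_ofReal (mono _ _ (h1 n))
    have : μ Set.univ ≤ ENNReal.ofReal (Λ 1) := by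
      calc μ Set.univ = ∫⁻ z, Filter.liminf (fun n => ENNReal.ofReal (χ n z)) Filter.atTop ∂μ := by
            rw [← lintegral_one]
            congr 1
            ext z
            have := ((ENNReal.continuous_ofReal.tendsto 1).comp (hlim z)).liminf_eq
            rw [ENNReal.ofReal_one] at this
            exact this.symm
        _ ≤ Filter.liminf (fun n => ∫⁻ z, ENNReal.ofReal (χ n z) ∂μ) Filter.atTop :=
            lintegral_liminf_le (fun n => (χ n).continuous.measurable.ennreal_ofReal)
        _ ≤ ENNReal.ofReal (Λ 1) :=
            Filter.liminf_le_of_le (by isBoundedDefault) (fun b hb' => by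
              obtain ⟨n, hn⟩ := hb'.exists
              exact hn.trans (hb n))
    exact this.trans_lt ENNReal.ofReal_lt_top
  refine ⟨μ, hfin, fun h => ?_⟩
  let p : ℕ → C_c(Z, ℝ) := fun n => ⟨⟨fun z => h z * χ n z, by fun_prop⟩, (χ n).hasCompactSupport.mul_left⟩
  have hp : ∀ n z, p n z = h z * χ n z := fun n z => rfl
  have l1 : Filter.Tendsto (fun n => ∫ z, p n z ∂μ) Filter.atTop (nhds (∫ z, h z ∂μ)) := by
    refine tendsto_integral_of_dominated_convergence (fun _ => ‖h‖) ?_ (integrable_const _) ?_ ?_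
    · intro n; exact (p n).continuous.measurable.aestronglyMeasurable
    · intro n
      refine Filter.Eventually.of_forall fun z => ?_
      rw [hp, norm_mul]
      have h2 : ‖χ n z‖ ≤ 1 := by rw [Real.norm_eq_abs, abs_of_nonneg (h0 n z)]; exact h1 n z
      calc _ ≤ ‖h‖ * 1 := by gcongr; exact h.norm_coe_le_norm z
        _ = _ := mul_one _
    · refine Filter.Eventually.of_forall fun z => ?_
      simpa [hp] using (hlim z).const_mul (h z)
  have l2 : Filter.Tendsto (fun n => ∫ z, p n z ∂μ) Filter.atTop (nhds (Λ h)) := by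
    simp_rw [hμ, hΛc]
    rw [tendsto_iff_norm_sub_tendsto_zero]
    have l3 := ht.const_mul ‖h‖
    rw [mul_zero] at l3
    refine squeeze_zero (fun _ => norm_nonneg _) (fun n => ?_) l3
    rw [← map_sub, ← smul_eq_mul, ← map_smul, Real.norm_eq_abs, abs_le, ← map_neg]
    have hh : ∀ z, |h z| ≤ ‖h‖ := h.norm_coe_le_norm
    constructor
    · refine mono _ _ fun z => ?_
      have := hp n z
      simp [hp]
      have := (abs_le.1 (hh z)).2
      nlinarith [h1 n z, h0 n z]
    · refine mono _ _ fun z => ?_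
      simp [hp]
      have := (abs_le.1 (hh z)).1
      nlinarith [h1 n z, h0 n z]
  exact tendsto_nhds_unique l1 l2

noncomputable def cutU (n : ℕ) (t : ℝ) : ℝ := max 0 (min 1 ((n : ℝ) + 1 - |t|))

lemma cutU_cont (n : ℕ) : Continuous (cutU n) := by unfold cutU; fun_prop
lemma cutU_nonneg (n : ℕ) (t : ℝ) : 0 ≤ cutU n t := le_max_left _ _
lemma cutU_le (n : ℕ) (t : ℝ) : cutU n t ≤ 1 := max_le zero_le_one (min_le_left _ _)
lemma cutU_anti (n : ℕ) {s t : ℝ} (h : |s| ≤ |t|) : cutU n t ≤ cutU n s := by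
  unfold cutU; gcongr
lemma cutU_zero (n : ℕ) (t : ℝ) (h : (n : ℝ) + 1 ≤ |t|) : cutU n t = 0 := by
  unfold cutU
  exact max_eq_left ((min_le_right _ _).trans (by linarith))
lemma cutU_lim (t : ℝ) : Filter.Tendsto (fun n => cutU n t) Filter.atTop (nhds 1) := by
  obtain ⟨N, hN⟩ := exists_nat_ge |t|
  refine tendsto_const_nhds.congr' ?_
  filter_upwards [Filter.eventually_ge_atTop N] with n hn
  have : (N : ℝ) ≤ n := by exact_mod_cast hn
  unfold cutU
  rw [min_eq_left (by linarith), max_eq_right zero_le_one]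

lemma cut_ineq (n : ℕ) (x w y : ℝ) :
    (1 + |x| + |y|) * (1 - cutU n x * cutU n w * cutU n y) ≤
      (1 + |x|) * (3 * (1 - cutU n x) + (1 - cutU n w)) +
      (1 + |y|) * (3 * (1 - cutU n y) + (1 - cutU n w)) := by
  have hx0 := cutU_nonneg n x
  have hx1 := cutU_le n x
  have hy0 := cutU_nonneg n y
  have hy1 := cutU_le n y
  have hw0 := cutU_nonneg n w
  have hw1 := cutU_le n w
  have ax := abs_nonneg x
  have ay := abs_nonneg y
  have cross : |y| * (1 - cutU n x) ≤ |x| * (1 - cutU n x) + |y| * (1 - cutU n y) ∧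
      |x| * (1 - cutU n y) ≤ |x| * (1 - cutU n x) + |y| * (1 - cutU n y) := by
    have p1 : 0 ≤ |x| * (1 - cutU n x) := mul_nonneg ax (by linarith)
    have p2 : 0 ≤ |y| * (1 - cutU n y) := mul_nonneg ay (by linarith)
    rcases le_total |x| |y| with h | h
    · have := cutU_anti n h
      constructor
      · nlinarith
      · nlinarith
    · have := cutU_anti n h
      constructor
      · nlinarith
      · nlinarith
  generalize cutU n x = a at *
  generalize cutU n y = b at *
  generalize cutU n w = c at *
  generalize |x| = s at *
  generalize |y| = t at *
  have h1 : 1 - a * c * b ≤ (1 - a) + (1 - c) + (1 - b) := by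
    have : (1 - a) + (1 - c) - (1 - a * c) = (1 - a) * (1 - c) := by ring
    have q1 : 0 ≤ (1 - a) * (1 - c) := mul_nonneg (by linarith) (by linarith)
    have q3 : a * c ≤ 1 := by nlinarith
    have q4 : 0 ≤ (1 - a * c) * (1 - b) := mul_nonneg (by linarith) (by linarith)
    nlinarith
  have h2 := mul_le_mul_of_nonneg_left h1 (by linarith : 0 ≤ 1 + s + t)
  obtain ⟨c1, c2⟩ := cross
  nlinarith

open scoped BoundedContinuousFunction CompactlySupported in
lemma coupling_lemma {Ω : Type*} [MeasurableSpace Ω] {P : Measure Ω} [IsProbabilityMeasure P]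
    {X Y V : Ω → ℝ} (hX : Measurable X) (hY : Measurable Y) (hV : Measurable V)
    (hXi : Integrable X P) (hYi : Integrable Y P) (H : CxH P X Y V) :
    ∃ π : Measure ((ℝ × ℝ) × ℝ), IsProbabilityMeasure π ∧
      π.map Prod.fst = P.map (fun ω => (X ω, V ω)) ∧
      π.map (fun z => (z.2, z.1.2)) = P.map (fun ω => (Y ω, V ω)) ∧
      ∀ k : (ℝ × ℝ) →ᵇ ℝ, ∫ z, k z.1 * (z.2 - z.1.1) ∂π = 0 := by
  obtain ⟨Λ, hΛ⟩ := ext_lemma hX hY hV hXi hYi H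
  have hpos : ∀ h : ((ℝ × ℝ) × ℝ) →ᵇ ℝ, (∀ z, 0 ≤ h z) → 0 ≤ Λ h := by
    intro h hh
    have := hΛ 0 0 0 (-h) (fun x w y => by
      have : 0 ≤ (1 + |x| + |y|) * h ((x, w), y) := mul_nonneg (by positivity) (hh _)
      simpa using this)
    simpa using this
  let χ : ℕ → C_c((ℝ × ℝ) × ℝ, ℝ) := fun n =>
    ⟨⟨fun z => cutU n z.1.1 * cutU n z.1.2 * cutU n z.2, by
        have := cutU_cont n
        fun_prop⟩, by
      refine HasCompactSupport.intro (K := (Set.Icc (-((n:ℝ)+1)) ((n:ℝ)+1) ×ˢ Set.Icc (-((n:ℝ)+1)) ((n:ℝ)+1)) ×ˢ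
        Set.Icc (-((n:ℝ)+1)) ((n:ℝ)+1)) ((isCompact_Icc.prod isCompact_Icc).prod isCompact_Icc) ?_
      intro z hz
      have key : ∀ t : ℝ, t ∉ Set.Icc (-((n:ℝ)+1)) ((n:ℝ)+1) → cutU n t = 0 := by
        intro t ht
        apply cutU_zero
        by_contra hcon
        push Not at hcon
        exact ht ⟨(abs_lt.1 hcon).1.le, (abs_lt.1 hcon).2.le⟩
      simp only [Set.mem_prod, not_and_or] at hz
      simp only
      rcases hz with (h | h) | h
      · simp [key _ h]
      · simp [key _ h]
      · simp [key _ h]⟩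
  have hχ : ∀ n z, χ n z = cutU n z.1.1 * cutU n z.1.2 * cutU n z.2 := fun n z => rfl
  have hχ0 : ∀ n z, 0 ≤ χ n z := by
    intro n z
    rw [hχ]
    exact mul_nonneg (mul_nonneg (cutU_nonneg _ _) (cutU_nonneg _ _)) (cutU_nonneg _ _)
  have hχ1 : ∀ n z, χ n z ≤ 1 := by
    intro n z
    rw [hχ]
    exact mul_le_one₀ (mul_le_one₀ (cutU_le _ _) (cutU_nonneg _ _) (cutU_le _ _)) (cutU_nonneg _ _) (cutU_le _ _)
  let fn : ℕ → (ℝ × ℝ) →ᵇ ℝ := fun n => BoundedContinuousFunction.ofNormedAddCommGroup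
    (fun p => 3 * (1 - cutU n p.1) + (1 - cutU n p.2)) (by have := cutU_cont n; fun_prop) 4 (by
      intro p
      have := cutU_nonneg n p.1
      have := cutU_nonneg n p.2
      have := cutU_le n p.1
      have := cutU_le n p.2
      rw [Real.norm_eq_abs, abs_le]; constructor <;> linarith)
  have hfn : ∀ n p, fn n p = 3 * (1 - cutU n p.1) + (1 - cutU n p.2) := fun n p => rfl
  have hfl : ∀ {Z : Ω → ℝ}, Measurable Z → Integrable Z P →
      Filter.Tendsto (fun n => ∫ ω, (1 + |Z ω|) * fn n (Z ω, V ω) ∂P) Filter.atTop (nhds 0) := by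
    intro Z hZ hZi
    have e : (0:ℝ) = ∫ ω, (0:ℝ) ∂P := by simp
    rw [e]
    refine tendsto_integral_of_dominated_convergence (fun ω => (1 + |Z ω|) * 4) ?_
      (((integrable_const 1).add hZi.abs).mul_const 4) ?_ ?_
    · intro n
      have := (fn n).continuous.measurable
      exact Measurable.aestronglyMeasurable (by fun_prop)
    · intro n
      refine Filter.Eventually.of_forall fun ω => ?_
      rw [norm_mul, Real.norm_eq_abs, abs_of_nonneg (by positivity : 0 ≤ 1 + |Z ω|)]
      gcongr
      have := cutU_nonneg n (Z ω)
      have := cutU_nonneg n (V ω)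
      have := cutU_le n (Z ω)
      have := cutU_le n (V ω)
      rw [hfn, Real.norm_eq_abs, abs_le]; constructor <;> simp only <;> linarith
    · refine Filter.Eventually.of_forall fun ω => ?_
      have h1 := ((cutU_lim (Z ω)).const_sub 1).const_mul 3
      have h2 := (cutU_lim (V ω)).const_sub 1
      have h3 := (h1.add h2).const_mul (1 + |Z ω|)
      simpa [hfn] using h3
  have ht : Filter.Tendsto (fun n => Λ (1 - (χ n).toBoundedContinuousFunction)) Filter.atTop (nhds 0) := by
    have hs := (hfl hX hXi).add (hfl hY hYi)
    rw [add_zero] at hs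
    refine squeeze_zero (fun n => hpos _ fun z => ?_) (fun n => ?_) hs
    · simpa using hχ1 n z
    · refine hΛ (fn n) (fn n) 0 _ fun x w y => ?_
      have := cut_ineq n x w y
      simpa [hfn, hχ] using this
  have hχl : ∀ z, Filter.Tendsto (fun n => χ n z) Filter.atTop (nhds 1) := by
    intro z
    have := ((cutU_lim z.1.1).mul (cutU_lim z.1.2)).mul (cutU_lim z.2)
    simpa [hχ] using this
  obtain ⟨μ, hμf, hμ⟩ := rmk_lemma Λ hpos χ hχ0 hχ1 hχl ht
  let d : (ℝ × ℝ) × ℝ → NNReal := fun z => Real.toNNReal (1 + |z.1.1| + |z.2|)⁻¹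
  have hdpos : ∀ z : (ℝ × ℝ) × ℝ, 0 < 1 + |z.1.1| + |z.2| := fun z => by positivity
  have hdm : Measurable d := by
    apply Measurable.real_toNNReal
    fun_prop
  let π := μ.withDensity (fun z => (d z : ENNReal))
  have hd1 : ∀ z, d z ≤ 1 := by
    intro z
    rw [Real.toNNReal_le_one]
    exact inv_le_one_of_one_le₀ (by have := abs_nonneg z.1.1; have := abs_nonneg z.2; linarith)
  have hπf : IsFiniteMeasure π := by
    apply isFiniteMeasure_withDensity
    have : ∫⁻ z, (d z : ENNReal) ∂μ ≤ ∫⁻ z, 1 ∂μ :=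
      lintegral_mono fun z => ENNReal.coe_le_one_iff.2 (hd1 z)
    refine (this.trans_lt ?_).ne
    simp
  have key : ∀ (f g k : (ℝ × ℝ) →ᵇ ℝ) (F : (ℝ × ℝ) × ℝ → ℝ), Continuous F →
      (∃ C, ∀ x w y, |F ((x, w), y)| ≤ C * (1 + |x| + |y|)) →
      (∀ x w y, F ((x, w), y) = (1 + |x|) * f (x, w) + (1 + |y|) * g (y, w) + k (x, w) * (y - x)) →
      ∫ z, F z ∂π = ∫ ω, (1 + |X ω|) * f (X ω, V ω) ∂P + ∫ ω, (1 + |Y ω|) * g (Y ω, V ω) ∂P := by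
    rintro f g k F hF ⟨C, hC⟩ hE
    let h : ((ℝ × ℝ) × ℝ) →ᵇ ℝ := BoundedContinuousFunction.ofNormedAddCommGroup
      (fun z => (1 + |z.1.1| + |z.2|)⁻¹ * F z)
      (by
        refine Continuous.mul (Continuous.inv₀ (by fun_prop) fun z => (hdpos z).ne') hF) C (by
        intro z
        rw [norm_mul, norm_inv, Real.norm_eq_abs, Real.norm_eq_abs, abs_of_pos (hdpos z),
          inv_mul_le_iff₀ (hdpos z), mul_comm]
        exact hC z.1.1 z.1.2 z.2)
    have hh : ∀ z, h z = (1 + |z.1.1| + |z.2|)⁻¹ * F z := fun z => rfl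
    have e1 : ∫ z, F z ∂π = Λ h := by
      rw [← hμ h, integral_withDensity_eq_integral_smul hdm]
      congr 1
      ext z
      rw [hh, NNReal.smul_def, Real.coe_toNNReal _ (inv_nonneg.2 (hdpos z).le), smul_eq_mul]
    have hmul : ∀ x w y, (1 + |x| + |y|) * h ((x, w), y) = F ((x, w), y) := by
      intro x w y
      rw [hh]
      exact mul_inv_cancel_left₀ (hdpos ((x, w), y)).ne' _
    have i1 := hΛ f g k h (fun x w y => by rw [hmul, hE])
    have i2 := hΛ (-f) (-g) (-k) (-h) (fun x w y => by
      have := hmul x w y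
      rw [hE] at this
      simp only [BoundedContinuousFunction.coe_neg, Pi.neg_apply]
      linarith)
    simp only [BoundedContinuousFunction.coe_neg, Pi.neg_apply, mul_neg, integral_neg, map_neg] at i2
    rw [e1]
    linarith
  let dv : ((ℝ × ℝ) →ᵇ ℝ) → ((ℝ × ℝ) →ᵇ ℝ) := fun f => BoundedContinuousFunction.ofNormedAddCommGroup
      (fun p => (1 + |p.1|)⁻¹ * f p)
      (by
        refine Continuous.mul (Continuous.inv₀ (by fun_prop) fun p => ?_) f.continuous
        have : 0 < 1 + |p.1| := by positivity
        exact this.ne') ‖f‖ (by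
        intro p
        have h0 : 0 < 1 + |p.1| := by positivity
        rw [norm_mul, norm_inv, Real.norm_eq_abs, abs_of_pos h0, inv_mul_le_iff₀ h0]
        have := f.norm_coe_le_norm p
        have h1 := abs_nonneg p.1
        have h2 := norm_nonneg f
        nlinarith)
  have hdv : ∀ f p, (1 + |p.1|) * dv f p = f p := by
    intro f p
    have h0 : 0 < 1 + |p.1| := by positivity
    exact mul_inv_cancel_left₀ h0.ne' _
  have hbd : ∀ (f : (ℝ × ℝ) →ᵇ ℝ) p (x y : ℝ), |f p| ≤ ‖f‖ * (1 + |x| + |y|) := by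
    intro f p x y
    have h0 := f.norm_coe_le_norm p
    rw [Real.norm_eq_abs] at h0
    have h1 := abs_nonneg x
    have h2 := norm_nonneg f
    have h3 := abs_nonneg y
    nlinarith [mul_nonneg h2 h1, mul_nonneg h2 h3]
  have m1 : π.map Prod.fst = P.map (fun ω => (X ω, V ω)) := by
    have := Measure.isProbabilityMeasure_map (μ := P) (hX.prodMk hV).aemeasurable
    apply ext_of_forall_integral_eq_of_IsFiniteMeasure
    intro f
    have hf := f.continuous
    rw [integral_map measurable_fst.aemeasurable f.continuous.measurable.aestronglyMeasurable,
      integral_map (hX.prodMk hV).aemeasurable f.continuous.measurable.aestronglyMeasurable,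
      key (dv f) 0 0 (fun z => f z.1) (by fun_prop) ⟨‖f‖, fun x w y => hbd _ _ _ _⟩
        (fun x w y => by rw [hdv f (x, w)]; simp)]
    have : ∀ ω, (1 + |X ω|) * dv f (X ω, V ω) = f (X ω, V ω) := fun ω => hdv f (X ω, V ω)
    simp [this]
  have m2 : π.map (fun z => (z.2, z.1.2)) = P.map (fun ω => (Y ω, V ω)) := by
    have := Measure.isProbabilityMeasure_map (μ := P) (hY.prodMk hV).aemeasurable
    apply ext_of_forall_integral_eq_of_IsFiniteMeasure
    intro f
    have hf := f.continuous
    rw [integral_map (by fun_prop) f.continuous.measurable.aestronglyMeasurable,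
      integral_map (hY.prodMk hV).aemeasurable f.continuous.measurable.aestronglyMeasurable,
      key 0 (dv f) 0 (fun z => f (z.2, z.1.2)) (by fun_prop) ⟨‖f‖, fun x w y => hbd _ _ _ _⟩
        (fun x w y => by rw [hdv f (y, w)]; simp)]
    have : ∀ ω, (1 + |Y ω|) * dv f (Y ω, V ω) = f (Y ω, V ω) := fun ω => hdv f (Y ω, V ω)
    simp [this]
  refine ⟨π, ?_, m1, m2, ?_⟩
  · have h1 := Measure.isProbabilityMeasure_map (μ := P) (hX.prodMk hV).aemeasurable
    rw [← m1] at h1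
    exact (Measure.isProbabilityMeasure_map_iff measurable_fst.aemeasurable).1 h1
  · intro k
    have hk := k.continuous
    rw [key 0 0 k (fun z => k z.1 * (z.2 - z.1.1)) (by fun_prop) ⟨‖k‖, fun x w y => ?_⟩
      (fun x w y => by simp)]
    · simp
    · rw [abs_mul]
      have := abs_sub y x
      gcongr
      · exact k.norm_coe_le_norm _
      · linarith

open ProbabilityTheory in
open scoped BoundedContinuousFunction in
lemma kernel_lemma {Ω : Type*} [MeasurableSpace Ω] {P : Measure Ω} [IsProbabilityMeasure P]
    {X Y V : Ω → ℝ} (hX : Measurable X) (hY : Measurable Y) (hV : Measurable V)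
    (hXi : Integrable X P) (hYi : Integrable Y P) (H : CxH P X Y V) :
    ∃ κ : Kernel (ℝ × ℝ) ℝ, IsMarkovKernel κ ∧
      ((P.map (fun ω => (X ω, V ω))) ⊗ₘ κ).map (fun z => (z.2, z.1.2)) = P.map (fun ω => (Y ω, V ω)) ∧
      ∀ᵐ p ∂(P.map (fun ω => (X ω, V ω))), ∫ y, y ∂(κ p) = p.1 := by
  obtain ⟨π, hπ, m1, m2, hk⟩ := coupling_lemma hX hY hV hXi hYi H
  have hdis : π.fst ⊗ₘ π.condKernel = π := π.disintegrate _
  have hf : π.fst = P.map (fun ω => (X ω, V ω)) := m1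
  have hp : IsProbabilityMeasure (P.map (fun ω => (X ω, V ω))) :=
    Measure.isProbabilityMeasure_map (hX.prodMk hV).aemeasurable
  rw [hf] at hdis
  refine ⟨π.condKernel, inferInstance, by rw [hdis, m2], ?_⟩
  set ρ := P.map (fun ω => (X ω, V ω)) with hρ
  have iy : Integrable (fun z : (ℝ × ℝ) × ℝ => z.2) π := by
    have : Integrable (fun p : ℝ × ℝ => p.1) (π.map (fun z => (z.2, z.1.2))) := by
      rw [m2, integrable_map_measure measurable_fst.aestronglyMeasurable (hY.prodMk hV).aemeasurable]
      exact hYi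
    rwa [integrable_map_measure measurable_fst.aestronglyMeasurable (by fun_prop)] at this
  have ix0 : Integrable (fun p : ℝ × ℝ => p.1) ρ := by
    rw [hρ, integrable_map_measure measurable_fst.aestronglyMeasurable (hX.prodMk hV).aemeasurable]
    exact hXi
  have ix : Integrable (fun z : (ℝ × ℝ) × ℝ => z.1.1) π := by
    rw [← m1] at ix0
    rwa [integrable_map_measure measurable_fst.aestronglyMeasurable (by fun_prop)] at ix0
  have iyk : Integrable (fun p => ∫ y, y ∂(π.condKernel p)) ρ := by
    have := iy.integral_condKernel
    rwa [hf] at this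
  have hae : ∀ᵐ p ∂ρ, Integrable (fun y => y) (π.condKernel p) := by
    have := iy.condKernel_ae
    rwa [hf] at this
  have := ae_eq_zero_of_integral_contDiff_smul_eq_zero (μ := ρ)
    (f := fun p => ∫ y, y ∂(π.condKernel p) - p.1) (iyk.sub ix0).locallyIntegrable (by
      intro g hg hgc
      obtain ⟨C, hC⟩ := hgc.exists_bound_of_continuous hg.continuous
      let k : (ℝ × ℝ) →ᵇ ℝ := BoundedContinuousFunction.ofNormedAddCommGroup g hg.continuous C hC
      have h1 := hk k
      have i2 : Integrable (fun z : (ℝ × ℝ) × ℝ => k z.1 * (z.2 - z.1.1)) (ρ ⊗ₘ π.condKernel) := by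
        rw [hdis]
        refine Integrable.bdd_mul (c := C) (iy.sub ix) ?_ (Filter.Eventually.of_forall fun z => hC z.1)
        exact (k.continuous.comp continuous_fst).aestronglyMeasurable
      rw [← hdis, Measure.integral_compProd i2] at h1
      rw [← h1]
      refine integral_congr_ae ?_
      filter_upwards [hae] with p hp
      rw [integral_const_mul, integral_sub hp (integrable_const _)]
      simp [k])
  filter_upwards [this] with p hp
  linarith

open ProbabilityTheory in
lemma map_compProd_comap {A B : Type*} [MeasurableSpace A] [MeasurableSpace B] (ρ : Measure A)
    [IsProbabilityMeasure ρ] (j : A → B) (hj : Measurable j) (κ : Kernel B ℝ) [IsMarkovKernel κ] :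
    (ρ ⊗ₘ (κ.comap j hj)).map (fun z => (j z.1, z.2)) = (ρ.map j) ⊗ₘ κ := by
  have := Measure.isProbabilityMeasure_map (μ := ρ) hj.aemeasurable
  ext s hs
  have hm : Measurable (fun z : A × ℝ => (j z.1, z.2)) := by fun_prop
  rw [Measure.map_apply hm hs, Measure.compProd_apply (hm hs), Measure.compProd_apply hs,
    lintegral_map (Kernel.measurable_kernel_prodMk_left hs) hj]
  rfl

open ProbabilityTheory in
lemma transfer_lemma {Ω Ω' E : Type*} [MeasurableSpace Ω] [MeasurableSpace Ω'] [MeasurableSpace E]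
    (P : Measure Ω) [IsProbabilityMeasure P] (P' : Measure Ω') [IsProbabilityMeasure P']
    {X Y : Ω → ℝ} {W : Ω → E} {X' Y' : Ω' → ℝ} {W' : Ω' → E}
    (hX : Measurable X) (hY : Measurable Y) (hW : Measurable W)
    (hX' : Measurable X') (hY' : Measurable Y') (hW' : Measurable W')
    (e1 : P'.map (fun ω => (X' ω, W' ω)) = P.map (fun ω => (X ω, W ω)))
    (e2 : P'.map (fun ω => (Y' ω, W' ω)) = P.map (fun ω => (Y ω, W ω)))
    (φ : ℝ → ℝ) (hφ : Continuous φ) (iX : Integrable (fun ω => φ (X ω)) P)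
    (iY : Integrable (fun ω => φ (Y ω)) P) (iX' : Integrable (fun ω => φ (X' ω)) P')
    (iY' : Integrable (fun ω => φ (Y' ω)) P')
    (h : P'[(fun ω => φ (X' ω)) | MeasurableSpace.comap W' inferInstance]
      ≤ᵐ[P'] P'[(fun ω => φ (Y' ω)) | MeasurableSpace.comap W' inferInstance]) :
    P[(fun ω => φ (X ω)) | MeasurableSpace.comap W inferInstance]
      ≤ᵐ[P] P[(fun ω => φ (Y ω)) | MeasurableSpace.comap W inferInstance] := by
  have hsm : StronglyMeasurable φ := hφ.stronglyMeasurable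
  have sw : ∀ {Z : Ω → ℝ} {Z' : Ω' → ℝ}, Measurable Z → Measurable Z' →
      P'.map (fun ω => (Z' ω, W' ω)) = P.map (fun ω => (Z ω, W ω)) →
      P'.map (fun ω => (W' ω, Z' ω)) = P.map (fun ω => (W ω, Z ω)) := by
    intro Z Z' hZ hZ' e
    have := congrArg (Measure.map Prod.swap) e
    rwa [Measure.map_map measurable_swap (hZ'.prodMk hW'),
      Measure.map_map measurable_swap (hZ.prodMk hW)] at this
  have hWlaw : P'.map W' = P.map W := by
    have := congrArg (Measure.map Prod.snd) e1
    rwa [Measure.map_map measurable_snd (hX'.prodMk hW'),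
      Measure.map_map measurable_snd (hX.prodMk hW)] at this
  have c1 : condDistrib X' W' P' = condDistrib X W P := by
    rw [condDistrib, condDistrib]; congr 1; exact sw hX hX' e1
  have c2 : condDistrib Y' W' P' = condDistrib Y W P := by
    rw [condDistrib, condDistrib]; congr 1; exact sw hY hY' e2
  have a1 := condExp_ae_eq_integral_condDistrib hW hX.aemeasurable hsm iX
  have a2 := condExp_ae_eq_integral_condDistrib hW hY.aemeasurable hsm iY
  have a1' := condExp_ae_eq_integral_condDistrib hW' hX'.aemeasurable hsm iX'
  have a2' := condExp_ae_eq_integral_condDistrib hW' hY'.aemeasurable hsm iY'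
  rw [c1] at a1'
  rw [c2] at a2'
  have m1 : Measurable fun w => ∫ y, φ y ∂(condDistrib X W P w) :=
    (StronglyMeasurable.integral_kernel hsm).measurable
  have m2 : Measurable fun w => ∫ y, φ y ∂(condDistrib Y W P w) :=
    (StronglyMeasurable.integral_kernel hsm).measurable
  have hl : ∀ᵐ w ∂(P'.map W'), ∫ y, φ y ∂(condDistrib X W P w) ≤ ∫ y, φ y ∂(condDistrib Y W P w) := by
    rw [ae_map_iff hW'.aemeasurable (measurableSet_le m1 m2)]
    filter_upwards [h, a1', a2'] with ω h1 h2 h3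
    rw [← h2, ← h3]; exact h1
  rw [hWlaw] at hl
  have hl' := ae_of_ae_map hW.aemeasurable hl
  filter_upwards [hl', a1, a2] with ω h1 h2 h3
  rw [h2, h3]; exact h1

lemma integrable_of_map_eq {Ω Ω' E : Type*} [MeasurableSpace Ω] [MeasurableSpace Ω'] [MeasurableSpace E]
    {P : Measure Ω} {P' : Measure Ω'} {Y : Ω → ℝ} {W : Ω → E} {Y' : Ω' → ℝ} {W' : Ω' → E}
    (hY : Measurable Y) (hW : Measurable W) (hY' : Measurable Y') (hW' : Measurable W')
    (e2 : P'.map (fun ω => (Y' ω, W' ω)) = P.map (fun ω => (Y ω, W ω)))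
    (φ : ℝ → ℝ) (hφ : Measurable φ) (iY : Integrable (fun ω => φ (Y ω)) P) :
    Integrable (fun ω => φ (Y' ω)) P' := by
  have hm : Measurable (fun p : ℝ × E => φ p.1) := hφ.comp measurable_fst
  have : Integrable (fun p : ℝ × E => φ p.1) (P.map (fun ω => (Y ω, W ω))) := by
    rw [integrable_map_measure hm.aestronglyMeasurable (hY.prodMk hW).aemeasurable]
    exact iY
  rw [← e2, integrable_map_measure hm.aestronglyMeasurable (hY'.prodMk hW').aemeasurable] at this
  exact this

/-- **Conditional Strassen theorem / existence of the observation-driven lift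
(single-time-step content of Theorem 3.5 of the paper).**
For integrable real random variables `Θ, Y`, a random variable `W` with values in a
standard Borel space, and a measurable `m : ℝ → ℝ` with `m(Θ)` integrable, the following
are equivalent: (i) there is a coupling `(Θ*, Y*, W*)` on some probability space with
`(Θ*, W*) ∼ (Θ, W)`, `(Y*, W*) ∼ (Y, W)` and `E[Y* | σ(Θ*) ⊔ σ(W*)] = m(Θ*)` a.s.;
(ii) `E[m(Θ) | σ(W)] = E[Y | σ(W)]` a.s. and for every convex `φ` with `φ(m(Θ))` and
`φ(Y)` integrable, `E[φ(m(Θ)) | σ(W)] ≤ E[φ(Y) | σ(W)]` a.s. -/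
theorem stmt_5 {Ω : Type} [mΩ : MeasurableSpace Ω] (P : Measure Ω) [IsProbabilityMeasure P]
    {E : Type} [MeasurableSpace E] [StandardBorelSpace E]
    (Θ Y : Ω → ℝ) (W : Ω → E) (m : ℝ → ℝ)
    (hΘmeas : Measurable Θ) (hYmeas : Measurable Y) (hWmeas : Measurable W)
    (hmmeas : Measurable m)
    (hΘint : Integrable Θ P) (hYint : Integrable Y P)
    (hmΘint : Integrable (fun ω => m (Θ ω)) P) :
    (∃ (Ω' : Type) (mΩ' : MeasurableSpace Ω') (P' : Measure Ω')
        (_ : IsProbabilityMeasure P') (Θ' Y' : Ω' → ℝ) (W' : Ω' → E),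
        Measurable Θ' ∧ Measurable Y' ∧ Measurable W' ∧
        Measure.map (fun ω => (Θ' ω, W' ω)) P' = Measure.map (fun ω => (Θ ω, W ω)) P ∧
        Measure.map (fun ω => (Y' ω, W' ω)) P' = Measure.map (fun ω => (Y ω, W ω)) P ∧
        P'[Y' | MeasurableSpace.comap Θ' inferInstance ⊔ MeasurableSpace.comap W' inferInstance]
          =ᵐ[P'] fun ω => m (Θ' ω))
    ↔ ((P[(fun ω => m (Θ ω)) | MeasurableSpace.comap W inferInstance]
          =ᵐ[P] P[Y | MeasurableSpace.comap W inferInstance])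
        ∧ ∀ φ : ℝ → ℝ, ConvexOn ℝ Set.univ φ →
            Integrable (fun ω => φ (m (Θ ω))) P → Integrable (fun ω => φ (Y ω)) P →
            P[(fun ω => φ (m (Θ ω))) | MeasurableSpace.comap W inferInstance]
              ≤ᵐ[P] P[(fun ω => φ (Y ω)) | MeasurableSpace.comap W inferInstance]) := by
  constructor
  · rintro ⟨Ω', mΩ', P', hP', Θ', Y', W', hΘ', hY', hW', e1, e2, hce⟩
    have hm : MeasurableSpace.comap Θ' inferInstance ⊔ MeasurableSpace.comap W' inferInstance ≤ mΩ' :=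
      sup_le hΘ'.comap_le hW'.comap_le
    have hle : MeasurableSpace.comap W' inferInstance ≤
        MeasurableSpace.comap Θ' inferInstance ⊔ MeasurableSpace.comap W' inferInstance := le_sup_right
    have e1' : P'.map (fun ω => (m (Θ' ω), W' ω)) = P.map (fun ω => (m (Θ ω), W ω)) := by
      have hmm : Measurable (fun p : ℝ × E => (m p.1, p.2)) := by fun_prop
      have := congrArg (Measure.map (fun p : ℝ × E => (m p.1, p.2))) e1
      rwa [Measure.map_map hmm (hΘ'.prodMk hW'), Measure.map_map hmm (hΘmeas.prodMk hWmeas)] at this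
    have hX := hmmeas.comp hΘmeas
    have hX' := hmmeas.comp hΘ'
    have iY' : Integrable Y' P' :=
      integrable_of_map_eq hYmeas hWmeas hY' hW' e2 id measurable_id hYint
    have iX' : Integrable (fun ω => m (Θ' ω)) P' :=
      integrable_of_map_eq hX hWmeas hX' hW' e1' id measurable_id hmΘint
    have heq : P'[(fun ω => m (Θ' ω)) | MeasurableSpace.comap W' inferInstance]
        =ᵐ[P'] P'[Y' | MeasurableSpace.comap W' inferInstance] :=
      (condExp_congr_ae hce.symm).trans (condExp_condExp_of_le hle hm)
    refine ⟨?_, ?_⟩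
    · refine Filter.EventuallyLE.antisymm ?_ ?_
      · exact transfer_lemma P P' hX hYmeas hWmeas hX' hY' hW' e1' e2 id continuous_id
          hmΘint hYint iX' iY' heq.le
      · exact transfer_lemma P P' hYmeas hX hWmeas hY' hX' hW' e2 e1' id continuous_id
          hYint hmΘint iY' iX' heq.symm.le
    · intro φ hφ i1 i2
      have hφc : Continuous φ := continuousOn_univ.1 (hφ.continuousOn isOpen_univ)
      have j1 := integrable_of_map_eq hX hWmeas hX' hW' e1' φ hφc.measurable i1
      have j2 := integrable_of_map_eq hYmeas hWmeas hY' hW' e2 φ hφc.measurable i2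
      refine transfer_lemma P P' hX hYmeas hWmeas hX' hY' hW' e1' e2 φ hφc i1 i2 j1 j2 ?_
      have hJ := hφ.map_condExp_le_of_finiteDimensional hm iY' j2
      have hJ' : (fun ω => φ (m (Θ' ω))) ≤ᵐ[P'] P'[(fun ω => φ (Y' ω)) |
          MeasurableSpace.comap Θ' inferInstance ⊔ MeasurableSpace.comap W' inferInstance] := by
        filter_upwards [hJ, hce] with ω h1 h2
        rw [← h2]; exact h1
      exact (condExp_mono j1 integrable_condExp hJ').trans (condExp_condExp_of_le hle hm).le
  · rintro ⟨-, hcx⟩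
    have he := measurableEmbedding_embeddingReal E
    set e := embeddingReal E
    have hX : Measurable (fun ω => m (Θ ω)) := hmmeas.comp hΘmeas
    have hV : Measurable (fun ω => e (W ω)) := he.measurable.comp hWmeas
    have H : CxH P (fun ω => m (Θ ω)) Y (fun ω => e (W ω)) := by
      intro φ hφ i1 i2 A hA
      have hms : MeasurableSet[MeasurableSpace.comap W inferInstance] ((fun ω => e (W ω)) ⁻¹' A) :=
        ⟨e ⁻¹' A, he.measurable hA, rfl⟩
      rw [← setIntegral_condExp hWmeas.comap_le i1 hms, ← setIntegral_condExp hWmeas.comap_le i2 hms]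
      exact setIntegral_mono_ae integrable_condExp.integrableOn integrable_condExp.integrableOn
        (hcx φ hφ i1 i2)
    obtain ⟨κ, hκ, hmap, hmean⟩ := kernel_lemma hX hYmeas hV hmΘint hYint H
    let ρ := P.map (fun ω => (Θ ω, W ω))
    have hρ : IsProbabilityMeasure ρ :=
      Measure.isProbabilityMeasure_map (hΘmeas.prodMk hWmeas).aemeasurable
    let j : ℝ × E → ℝ × ℝ := fun p => (m p.1, e p.2)
    have hj : Measurable j := (hmmeas.comp measurable_fst).prodMk (he.measurable.comp measurable_snd)
    have hρj : ρ.map j = P.map (fun ω => (m (Θ ω), e (W ω))) :=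
      Measure.map_map hj (hΘmeas.prodMk hWmeas)
    let P' : Measure ((ℝ × E) × ℝ) := ρ.compProd (κ.comap j hj)
    have hfst : P'.map Prod.fst = ρ := Measure.fst_compProd _ _
    have eY : P'.map (fun z => (z.2, z.1.2)) = P.map (fun ω => (Y ω, W ω)) := by
      have hem : MeasurableEmbedding (Prod.map (id : ℝ → ℝ) e) := MeasurableEmbedding.id.prodMap he
      rw [← hem.comap_map (P'.map (fun z => (z.2, z.1.2))), ← hem.comap_map (P.map (fun ω => (Y ω, W ω)))]
      congr 1
      rw [Measure.map_map hem.measurable (by fun_prop),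
        Measure.map_map hem.measurable (hYmeas.prodMk hWmeas)]
      rw [← hρj, ← map_compProd_comap ρ j hj κ, Measure.map_map (by fun_prop) (by fun_prop)] at hmap
      exact hmap
    have iY' : Integrable (fun z : (ℝ × E) × ℝ => z.2) P' :=
      integrable_of_map_eq (W' := fun z : (ℝ × E) × ℝ => z.1.2) hYmeas hWmeas (by fun_prop)
        (by fun_prop) eY id measurable_id hYint
    have iX' : Integrable (fun z : (ℝ × E) × ℝ => m z.1.1) P' :=
      integrable_of_map_eq (Y' := fun z : (ℝ × E) × ℝ => z.1.1)
        (W' := fun z : (ℝ × E) × ℝ => z.1.2) hΘmeas hWmeas (by fun_prop)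
        (by fun_prop) hfst m hmmeas hmΘint
    refine ⟨(ℝ × E) × ℝ, inferInstance, P', inferInstance, fun z => z.1.1, fun z => z.2,
      fun z => z.1.2, by fun_prop, by fun_prop, by fun_prop, hfst, eY, ?_⟩
    have hsig : MeasurableSpace.comap (fun z : (ℝ × E) × ℝ => z.1.1) inferInstance ⊔
        MeasurableSpace.comap (fun z : (ℝ × E) × ℝ => z.1.2) inferInstance =
        MeasurableSpace.comap (Prod.fst : (ℝ × E) × ℝ → ℝ × E) inferInstance :=
      (MeasurableSpace.comap_prodMk _ _).symm
    rw [hsig]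
    refine (ae_eq_condExp_of_forall_setIntegral_eq measurable_fst.comap_le iY'
      (fun s _ _ => iX'.integrableOn) ?_ ?_).symm
    · rintro s ⟨A, hA, rfl⟩ -
      have hs : (Prod.fst : (ℝ × E) × ℝ → ℝ × E) ⁻¹' A = A ×ˢ Set.univ := by ext; simp
      rw [hs, Measure.setIntegral_compProd hA MeasurableSet.univ iX'.integrableOn,
        Measure.setIntegral_compProd hA MeasurableSet.univ iY'.integrableOn]
      refine integral_congr_ae (ae_restrict_of_ae ?_)
      rw [← hρj] at hmean
      filter_upwards [ae_of_ae_map hj.aemeasurable hmean] with p hp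
      simp [hp, ProbabilityTheory.Kernel.comap_apply, j] 
    · have : Measurable[MeasurableSpace.comap (Prod.fst : (ℝ × E) × ℝ → ℝ × E) inferInstance]
          (fun z : (ℝ × E) × ℝ => m z.1.1) :=
        (hmmeas.comp measurable_fst).comp (comap_measurable _)
      exact this.stronglyMeasurable.aestronglyMeasurable
end

section
/- Let a > 0, b > 0, q > 0, Δ ≥ 0 and c ≥ 0 with Δa + cb > 0. Let Θ be a random variable with Gamma(a, b) distribution and let Y be a random variable with Gamma(q(Δa + cb), qb) distribution (so that E[Y] = Δa/b + c = E[ΔΘ + c]), and set X := ΔΘ + c. Then X ⪯_cx Y (i.e., E[φ(X)] ≤ E[φ(Y)] for every convex function φ : ℝ → ℝ such that φ(X) and φ(Y) are both integrable) if and only if Δq ≤ 1. -/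
open MeasureTheory ProbabilityTheory

lemma gm_integrable_iff {a r : ℝ} (ha : 0 < a) (hr : 0 < r) (f : ℝ → ℝ) :
    Integrable f (gammaMeasure a r) ↔ Integrable (fun x => f x * gammaPDFReal a r x) := by
  unfold gammaMeasure
  rw [integrable_withDensity_iff_integrable_smul']
  · simp only [gammaPDF, ENNReal.toReal_ofReal (gammaPDFReal_nonneg ha hr _), smul_eq_mul, mul_comm]
  · exact (measurable_gammaPDFReal a r).ennreal_ofReal
  · exact Filter.Eventually.of_forall fun x => by simp [gammaPDF]

lemma gm_integral {a r : ℝ} (ha : 0 < a) (hr : 0 < r) (f : ℝ → ℝ) :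
    ∫ x, f x ∂(gammaMeasure a r) = ∫ x, f x * gammaPDFReal a r x := by
  unfold gammaMeasure
  rw [integral_withDensity_eq_integral_toReal_smul]
  · simp only [gammaPDF, ENNReal.toReal_ofReal (gammaPDFReal_nonneg ha hr _), smul_eq_mul, mul_comm]
  · exact (measurable_gammaPDFReal a r).ennreal_ofReal
  · exact Filter.Eventually.of_forall fun x => by simp [gammaPDF]

lemma gp_integrable {a r : ℝ} (ha : 0 < a) (hr : 0 < r) : Integrable (gammaPDFReal a r) := by
  have := isProbabilityMeasure_gammaMeasure ha hr
  simpa using (gm_integrable_iff ha hr (fun _ => 1)).1 (integrable_const _)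

lemma gp_integral {a r : ℝ} (ha : 0 < a) (hr : 0 < r) : ∫ x, gammaPDFReal a r x = 1 := by
  have := isProbabilityMeasure_gammaMeasure ha hr
  simpa using (gm_integral ha hr (fun _ => 1)).symm

lemma gp_mul_x {a r : ℝ} (ha : 0 < a) (hr : 0 < r) (x : ℝ) :
    x * gammaPDFReal a r x = a / r * gammaPDFReal (a + 1) r x := by
  unfold gammaPDFReal
  split_ifs with h
  · have hG := (Real.Gamma_pos_of_pos ha).ne'
    rw [Real.Gamma_add_one ha.ne', Real.rpow_add_one hr.ne', add_sub_cancel_right]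
    have : x * x ^ (a - 1) = x ^ a := by
      rcases h.eq_or_lt with h | h
      · rw [← h, Real.zero_rpow ha.ne', zero_mul]
      · rw [mul_comm, ← Real.rpow_add_one h.ne', sub_add_cancel]
    rw [← this]
    field_simp
  · simp

lemma gp_x_integrable {a r : ℝ} (ha : 0 < a) (hr : 0 < r) :
    Integrable (fun x => x * gammaPDFReal a r x) := by
  simp_rw [gp_mul_x ha hr]
  exact (gp_integrable (by linarith) hr).const_mul _

lemma gp_x_integral {a r : ℝ} (ha : 0 < a) (hr : 0 < r) :
    ∫ x, x * gammaPDFReal a r x = a / r := by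
  simp_rw [gp_mul_x ha hr]
  rw [integral_const_mul, gp_integral (by linarith) hr, mul_one]

lemma gp_exp {a r t : ℝ} (ha : 0 < a) (hr : 0 < r) (ht : t < r) (x : ℝ) :
    Real.exp (t * x) * gammaPDFReal a r x = (r / (r - t)) ^ a * gammaPDFReal a (r - t) x := by
  unfold gammaPDFReal
  split_ifs with h
  · have hrt : 0 < r - t := by linarith
    have h1 := (Real.rpow_pos_of_pos hrt a).ne'
    rw [Real.div_rpow hr.le hrt.le]
    have : Real.exp (-((r - t) * x)) = Real.exp (t * x) * Real.exp (-(r * x)) := by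
      rw [← Real.exp_add]; ring_nf
    rw [this]
    field_simp
  · simp

lemma gp_exp_integrable {a r t : ℝ} (ha : 0 < a) (hr : 0 < r) (ht : t < r) :
    Integrable (fun x => Real.exp (t * x)) (gammaMeasure a r) := by
  rw [gm_integrable_iff ha hr]
  simp_rw [gp_exp ha hr ht]
  exact (gp_integrable ha (by linarith)).const_mul _

lemma gp_exp_integral {a r t : ℝ} (ha : 0 < a) (hr : 0 < r) (ht : t < r) :
    ∫ x, Real.exp (t * x) ∂(gammaMeasure a r) = (r / (r - t)) ^ a := by
  rw [gm_integral ha hr]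
  simp_rw [gp_exp ha hr ht]
  rw [integral_const_mul, gp_integral ha (by linarith), mul_one]

lemma gp_scale {a r d : ℝ} (hr : 0 < r) (hd : 0 < d) (x : ℝ) :
    gammaPDFReal a r x = d * gammaPDFReal a (r / d) (d * x) := by
  unfold gammaPDFReal
  by_cases h : 0 ≤ x
  · have : 0 ≤ d * x := by positivity
    rw [if_pos h, if_pos this, Real.div_rpow hr.le hd.le, Real.mul_rpow hd.le h,
      Real.rpow_sub_one hd.ne']
    have h1 := (Real.rpow_pos_of_pos hd a).ne'
    have h2 : r / d * (d * x) = r * x := by field_simp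
    rw [h2]
    field_simp
  · have : ¬ 0 ≤ d * x := by
      intro h'; exact h (nonneg_of_mul_nonneg_right h' hd)
    rw [if_neg h, if_neg this, mul_zero]

lemma tangent {φ : ℝ → ℝ} (hφ : ConvexOn ℝ Set.univ φ) (u : ℝ) :
    ∃ k : ℝ, ∀ x, φ u + k * (x - u) ≤ φ x := by
  refine ⟨derivWithin φ (Set.Ioi u) u, fun x => ?_⟩
  have hu : u ∈ interior (Set.univ : Set ℝ) := by simp
  rcases lt_trichotomy x u with h | h | h
  · have h1 := hφ.slope_le_leftDeriv_of_mem_interior (Set.mem_univ x) hu h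
    have h2 := hφ.leftDeriv_le_rightDeriv_of_mem_interior hu
    have h3 := h1.trans h2
    rw [slope_def_field, div_le_iff₀ (by linarith)] at h3
    linarith
  · subst h; simp
  · have h1 := hφ.rightDeriv_le_slope_of_mem_interior hu (Set.mem_univ x) h
    rw [slope_def_field, le_div_iff₀ (by linarith)] at h1
    linarith

lemma cut_line {φ : ℝ → ℝ} (hφ : ConvexOn ℝ Set.univ φ) {S : Set ℝ} (hS : S.OrdConnected)
    (hb : BddBelow S) (hB : BddAbove S) :
    ∃ k m : ℝ, (∀ x ∈ S, φ x ≤ k * x + m) ∧ (∀ x, x ∉ S → k * x + m ≤ φ x) := by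
  rcases S.eq_empty_or_nonempty with he | hne
  · obtain ⟨k, hk⟩ := tangent hφ 0
    refine ⟨k, φ 0, by simp [he], fun x _ => by linarith [hk x]⟩
  have hle : ∀ x ∈ S, sInf S ≤ x ∧ x ≤ sSup S := fun x hx => ⟨csInf_le hb hx, le_csSup hB hx⟩
  have huv : sInf S ≤ sSup S := by
    obtain ⟨x, hx⟩ := hne
    linarith [hle x hx]
  rcases huv.eq_or_lt with h | h
  · obtain ⟨k, hk⟩ := tangent hφ (sInf S)
    refine ⟨k, φ (sInf S) - k * sInf S, fun x hx => ?_, fun x _ => by linarith [hk x]⟩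
    have : x = sInf S := le_antisymm (by linarith [hle x hx]) (hle x hx).1
    rw [this]; linarith
  · have hoff : ∀ x, x ∉ S → x ≤ sInf S ∨ sSup S ≤ x := by
      intro x hx
      by_contra! hcon
      obtain ⟨y, hy, hyx⟩ := exists_lt_of_csInf_lt hne hcon.1
      obtain ⟨z, hz, hzx⟩ := exists_lt_of_lt_csSup hne hcon.2
      exact hx (hS.out hy hz ⟨hyx.le, hzx.le⟩)
    generalize sInf S = u at *
    generalize sSup S = v at *
    have hvu : 0 < v - u := by linarith
    have key : ∀ x y z : ℝ, x < y → y < z → (z - x) * φ y ≤ (z - y) * φ x + (y - x) * φ z := by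
      intro x y z hxy hyz
      have := hφ.slope_mono_adjacent (Set.mem_univ x) (Set.mem_univ z) hxy hyz
      rw [div_le_div_iff₀ (by linarith) (by linarith)] at this
      linarith
    refine ⟨(φ v - φ u) / (v - u), φ u - (φ v - φ u) / (v - u) * u, fun x hx => ?_, fun x hx => ?_⟩
    · have e : (φ v - φ u) / (v - u) * x + (φ u - (φ v - φ u) / (v - u) * u)
        = ((v - x) * φ u + (x - u) * φ v) / (v - u) := by field_simp; ring
      rw [e, le_div_iff₀ hvu]
      rcases (hle x hx).1.eq_or_lt with h1 | h1
      · subst h1; linarith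
      rcases (hle x hx).2.eq_or_lt with h2 | h2
      · subst h2; linarith
      linarith [key u x v h1 h2]
    · have e : (φ v - φ u) / (v - u) * x + (φ u - (φ v - φ u) / (v - u) * u)
        = ((v - x) * φ u + (x - u) * φ v) / (v - u) := by field_simp; ring
      rw [e, div_le_iff₀ hvu]
      rcases hoff x hx with h1 | h1
      · rcases h1.eq_or_lt with h1 | h1
        · subst h1; linarith
        linarith [key x u v h1 h]
      · rcases h1.eq_or_lt with h1 | h1
        · subst h1; linarith
        linarith [key u v x h h1]

lemma cut {φ f g : ℝ → ℝ} (hφ : ConvexOn ℝ Set.univ φ) {S : Set ℝ} (hS : S.OrdConnected)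
    (hb : BddBelow S) (hB : BddAbove S) (hf0 : ∀ x, 0 ≤ f x)
    (hin : ∀ᵐ x, x ∈ S → g x ≤ f x) (hout : ∀ᵐ x, x ∉ S → f x ≤ g x)
    (hf : Integrable f) (hg : Integrable g) (hxf : Integrable fun x => x * f x)
    (hxg : Integrable fun x => x * g x) (h1 : ∫ x, f x = ∫ x, g x)
    (h2 : ∫ x, x * f x = ∫ x, x * g x) (hi : Integrable fun x => φ x * g x) :
    (Integrable fun x => φ x * f x) ∧ ∫ x, φ x * f x ≤ ∫ x, φ x * g x := by
  have hcont : Continuous φ := by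
    rw [← continuousOn_univ]; exact hφ.continuousOn isOpen_univ
  obtain ⟨l, hl⟩ := hb
  obtain ⟨L, hL⟩ := hB
  obtain ⟨M, hM⟩ := (isCompact_Icc (a := l) (b := L)).exists_bound_of_continuousOn hcont.continuousOn
  have hint : Integrable fun x => φ x * f x := by
    refine Integrable.mono' ((hf.const_mul |M|).add hi.norm) 
      (hcont.aestronglyMeasurable.mul hf.aestronglyMeasurable) ?_
    filter_upwards [hout] with x hx
    simp only [Pi.add_apply, norm_mul, Real.norm_eq_abs, abs_of_nonneg (hf0 x)]
    by_cases hxS : x ∈ S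
    · have := hM x ⟨hl hxS, hL hxS⟩
      rw [Real.norm_eq_abs] at this
      have := mul_le_mul_of_nonneg_right (this.trans (le_abs_self M)) (hf0 x)
      have : 0 ≤ |φ x| * |g x| := by positivity
      linarith
    · have := mul_le_mul_of_nonneg_left ((hx hxS).trans (le_abs_self (g x))) (abs_nonneg (φ x))
      have : 0 ≤ |M| * f x := mul_nonneg (abs_nonneg _) (hf0 x)
      linarith
  refine ⟨hint, ?_⟩
  obtain ⟨k, m, hk1, hk2⟩ := cut_line hφ hS ⟨l, hl⟩ ⟨L, hL⟩
  have hpos : 0 ≤ ∫ x, ((φ x * g x - φ x * f x) - (k * (x * g x - x * f x) + m * (g x - f x))) := by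
    apply integral_nonneg_of_ae
    filter_upwards [hin, hout] with x hx1 hx2
    have e : ((φ x * g x - φ x * f x) - (k * (x * g x - x * f x) + m * (g x - f x)))
      = (φ x - (k * x + m)) * (g x - f x) := by ring
    simp only [Pi.zero_apply]
    rw [e]
    by_cases hxS : x ∈ S
    · exact mul_nonneg_of_nonpos_of_nonpos (by linarith [hk1 x hxS]) (by linarith [hx1 hxS])
    · exact mul_nonneg (by linarith [hk2 x hxS]) (by linarith [hx2 hxS])
  have i1 : Integrable fun x => φ x * g x - φ x * f x := hi.sub hint
  have i2 : Integrable fun x => k * (x * g x - x * f x) := (hxg.sub hxf).const_mul k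
  have i3 : Integrable fun x => m * (g x - f x) := (hg.sub hf).const_mul m
  have i4 : Integrable fun x => k * (x * g x - x * f x) + m * (g x - f x) := i2.add i3
  rw [integral_sub i1 i4, integral_sub hi hint] at hpos
  have e : ∫ x, (k * (x * g x - x * f x) + m * (g x - f x)) = 0 := by
    rw [integral_add i2 i3, integral_const_mul, integral_const_mul, integral_sub hxg hxf,
      integral_sub hg hf, h1, h2]
    ring
  rw [e] at hpos
  linarith

lemma gp_log {a r x : ℝ} (ha : 0 < a) (hr : 0 < r) (hx : 0 < x) :
    gammaPDFReal a r x
      = Real.exp (Real.log (r ^ a / Real.Gamma a) + (a - 1) * Real.log x - r * x) := by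
  have hG := Real.Gamma_pos_of_pos ha
  rw [sub_eq_add_neg, Real.exp_add, Real.exp_add, Real.exp_log (by positivity), gammaPDFReal,
    if_pos hx.le, Real.rpow_def_of_pos hx, mul_comm (Real.log x)]

lemma step1 {φ : ℝ → ℝ} (hφ : ConvexOn ℝ Set.univ φ) {a r s : ℝ} (ha : 0 < a) (hs : 0 < s)
    (hsr : s ≤ r) (hi : Integrable fun x => φ x * gammaPDFReal (s * a / r) s x) :
    (Integrable fun x => φ x * gammaPDFReal a r x) ∧
      ∫ x, φ x * gammaPDFReal a r x ≤ ∫ x, φ x * gammaPDFReal (s * a / r) s x := by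
  have hr : 0 < r := hs.trans_le hsr
  rcases hsr.eq_or_lt with h | h
  · subst h
    rw [mul_div_cancel_left₀ _ hs.ne'] at *
    exact ⟨hi, le_rfl⟩
  have ha' : 0 < s * a / r := by positivity
  have hα : 0 ≤ a - s * a / r := by
    rw [sub_nonneg, div_le_iff₀ hr]; nlinarith
  set a' := s * a / r with ha'def
  set C := Real.log (r ^ a / Real.Gamma a) - Real.log (s ^ a' / Real.Gamma a') with hC
  have hiff : ∀ x, 0 < x → (gammaPDFReal a' s x ≤ gammaPDFReal a r x ↔
      0 ≤ (a - a') * Real.log x - (r - s) * x + C) := by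
    intro x hx
    rw [gp_log ha hr hx, gp_log ha' hs hx, Real.exp_le_exp, ← sub_nonneg]
    apply iff_of_eq; congr 1; rw [hC]; ring
  have hSeq : {x : ℝ | x ∈ Set.Ioi 0 ∧ gammaPDFReal a' s x ≤ gammaPDFReal a r x}
      = {x | x ∈ Set.Ioi (0:ℝ) ∧ 0 ≤ (a - a') * Real.log x - (r - s) * x + C} := by
    ext x
    exact and_congr_right fun hx => hiff x hx
  have hconc : ConcaveOn ℝ (Set.Ioi (0:ℝ)) fun x => (a - a') * Real.log x - (r - s) * x + C := by
    have h1 : ConcaveOn ℝ (Set.Ioi (0:ℝ)) fun x => (a - a') * Real.log x :=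
      strictConcaveOn_log_Ioi.concaveOn.smul hα
    refine ⟨convex_Ioi 0, fun x hx y hy α β h1' h2' h3' => ?_⟩
    have := h1.2 hx hy h1' h2' h3'
    simp only [smul_eq_mul] at *
    have : C = α * C + β * C := by rw [← add_mul, h3', one_mul]
    nlinarith
  refine cut (S := {x : ℝ | x ∈ Set.Ioi 0 ∧ gammaPDFReal a' s x ≤ gammaPDFReal a r x}) hφ ?_ ?_ ?_
    (gammaPDFReal_nonneg ha hr) ?_ ?_ (gp_integrable ha hr) (gp_integrable ha' hs)
    (gp_x_integrable ha hr) (gp_x_integrable ha' hs) ?_ ?_ hi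
  · rw [hSeq]
    exact (hconc.convex_ge 0).ordConnected
  · exact ⟨0, fun x hx => le_of_lt hx.1⟩
  · rw [hSeq]
    set δ := (r - s) / (2 * (a - a' + 1)) with hδ
    have hrs : 0 < r - s := by linarith
    have hδ0 : 0 < δ := by positivity
    refine ⟨(C + (a - a') * (-1 - Real.log δ)) / ((r - s) / 2), fun x hx => ?_⟩
    obtain ⟨hx0, hx1⟩ := hx
    have hx0 : 0 < x := hx0
    rw [le_div_iff₀ (by positivity)]
    have h1 := Real.log_le_sub_one_of_pos (mul_pos hδ0 hx0)
    rw [Real.log_mul hδ0.ne' hx0.ne'] at h1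
    have h2 : (a - a') * δ ≤ (r - s) / 2 := by
      rw [hδ, mul_div_assoc', div_le_div_iff₀ (by positivity) (by norm_num)]
      nlinarith
    have h3 := mul_le_mul_of_nonneg_right h2 hx0.le
    have h4 : (a - a') * Real.log x ≤ (a - a') * (δ * x - 1 - Real.log δ) :=
      mul_le_mul_of_nonneg_left (by linarith) hα
    nlinarith
  · exact Filter.Eventually.of_forall fun x hx => hx.2
  · filter_upwards [Measure.ae_ne volume (0:ℝ)] with x hx0 hx
    rcases lt_or_gt_of_ne hx0 with h0 | h0
    · simp [gammaPDFReal, not_le.2 h0]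
    · by_contra! hcon
      exact hx ⟨h0, hcon.le⟩
  · rw [gp_integral ha hr, gp_integral ha' hs]
  · rw [gp_x_integral ha hr, gp_x_integral ha' hs, ha'def]
    field_simp

lemma step2 {φ : ℝ → ℝ} (hφ : ConvexOn ℝ Set.univ φ) {a s c : ℝ} (ha : 0 < a) (hs : 0 < s)
    (hc : 0 ≤ c) (hi : Integrable fun x => φ x * gammaPDFReal (a + s * c) s x) :
    (Integrable fun x => φ x * gammaPDFReal a s (x - c)) ∧
      ∫ x, φ x * gammaPDFReal a s (x - c) ≤ ∫ x, φ x * gammaPDFReal (a + s * c) s x := by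
  rcases hc.eq_or_lt with h | hc
  · subst h
    simp only [mul_zero, add_zero, sub_zero] at *
    exact ⟨hi, le_rfl⟩
  have hk : 0 < a + s * c := by positivity
  have hsc : 0 < s * c := by positivity
  set C := Real.log (s ^ a / Real.Gamma a) - Real.log (s ^ (a + s * c) / Real.Gamma (a + s * c))
    + s * c with hC
  set h : ℝ → ℝ := fun w => (a - 1) * Real.log (1 - c * w) + s * c * Real.log w + C with hh
  have hiff : ∀ x, c < x → (gammaPDFReal (a + s * c) s x ≤ gammaPDFReal a s (x - c) ↔
      0 ≤ h x⁻¹) := by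
    intro x hx
    have hx0 : 0 < x := hc.trans hx
    have hxc : 0 < x - c := by linarith
    rw [gp_log ha hs hxc, gp_log hk hs hx0, Real.exp_le_exp, ← sub_nonneg]
    have e : 1 - c * x⁻¹ = (x - c) / x := by field_simp
    apply iff_of_eq; congr 1
    simp only [hh]
    rw [e, Real.log_div hxc.ne' hx0.ne', Real.log_inv, hC]
    ring
  set T : Set ℝ := {w | w ∈ Set.Ioo 0 c⁻¹ ∧ 0 ≤ h w} with hT
  have hpos : ∀ w ∈ Set.Ioo 0 c⁻¹, 0 < 1 - c * w := by
    intro w hw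
    have := mul_lt_mul_of_pos_left hw.2 hc
    rw [mul_inv_cancel₀ hc.ne'] at this
    linarith
  have hTo : T.OrdConnected := by
    rcases le_total 1 a with h1 | h1
    · have hconc : ConcaveOn ℝ (Set.Ioo 0 c⁻¹) h := by
        refine ⟨convex_Ioo _ _, fun x hx y hy α β hα hβ hαβ => ?_⟩
        have l1 := strictConcaveOn_log_Ioi.concaveOn.2 (hpos x hx) (hpos y hy) hα hβ hαβ
        have l2 := strictConcaveOn_log_Ioi.concaveOn.2 hx.1 hy.1 hα hβ hαβ
        simp only [smul_eq_mul, hh] at *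
        have e : α * (1 - c * x) + β * (1 - c * y) = 1 - c * (α * x + β * y) := by
          linear_combination hαβ
        rw [e] at l1
        have l1' := mul_le_mul_of_nonneg_left l1 (sub_nonneg.2 h1)
        have l2' := mul_le_mul_of_nonneg_left l2 hsc.le
        have : C = α * C + β * C := by rw [← add_mul, hαβ, one_mul]
        linarith
      exact (hconc.convex_ge 0).ordConnected
    · refine ⟨fun x hx y hy w hw => ?_⟩
      have hw' : w ∈ Set.Ioo 0 c⁻¹ := ⟨hx.1.1.trans_le hw.1, hw.2.trans_lt hy.1.2⟩
      refine ⟨hw', hx.2.trans ?_⟩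
      have l1 : Real.log (1 - c * w) ≤ Real.log (1 - c * x) :=
        Real.log_le_log (hpos w hw') (by nlinarith [hw.1])
      have l2 : Real.log x ≤ Real.log w := Real.log_le_log hx.1.1 hw.1
      have l1' := mul_le_mul_of_nonneg_left l1 (sub_nonneg.2 h1)
      have l2' := mul_le_mul_of_nonneg_left l2 hsc.le
      simp only [hh]
      linarith
  have hmem : ∀ x, (x ∈ Set.Ioi c ∧ gammaPDFReal (a + s * c) s x ≤ gammaPDFReal a s (x - c)) ↔
      (x ∈ Set.Ioi c ∧ x⁻¹ ∈ T) := by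
    intro x
    refine and_congr_right fun hx => ?_
    have hx : c < x := hx
    have hx0 : 0 < x := hc.trans hx
    rw [hiff x hx, hT]
    have : x⁻¹ ∈ Set.Ioo 0 c⁻¹ := ⟨by positivity, (inv_lt_inv₀ hx0 hc).2 hx⟩
    simp only [Set.mem_ofPred_eq, this, true_and]
  have hshift : ∫ x, x * gammaPDFReal a s (x - c) = a / s + c := by
    have := integral_sub_right_eq_self (μ := volume) (fun x => (x + c) * gammaPDFReal a s x) c
    simp only [sub_add_cancel] at this
    rw [this]
    simp_rw [add_mul]
    rw [integral_add (gp_x_integrable ha hs) ((gp_integrable ha hs).const_mul c),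
      integral_const_mul, gp_integral ha hs, gp_x_integral ha hs, mul_one]
  have hshifti : Integrable fun x => x * gammaPDFReal a s (x - c) := by
    have h0 : Integrable fun x => (x + c) * gammaPDFReal a s x := by
      simp_rw [add_mul]
      exact (gp_x_integrable ha hs).add ((gp_integrable ha hs).const_mul c)
    simpa using h0.comp_sub_right c
  refine cut (S := {x : ℝ | x ∈ Set.Ioi c ∧
      gammaPDFReal (a + s * c) s x ≤ gammaPDFReal a s (x - c)}) hφ ?_ ?_ ?_
    (fun x => gammaPDFReal_nonneg ha hs _) ?_ ?_ ((gp_integrable ha hs).comp_sub_right c)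
    (gp_integrable hk hs) hshifti (gp_x_integrable hk hs) ?_ ?_ hi
  · refine ⟨fun x hx y hy z hz => ?_⟩
    have hx' := (hmem x).1 hx
    have hy' := (hmem y).1 hy
    have hx0 : 0 < x := hc.trans hx'.1
    have hz0 : 0 < z := hx0.trans_le hz.1
    refine (hmem z).2 ⟨lt_of_lt_of_le hx'.1 hz.1, hTo.out hy'.2 hx'.2 ⟨?_, ?_⟩⟩
    · exact inv_anti₀ hz0 hz.2
    · exact inv_anti₀ hx0 hz.1
  · exact ⟨c, fun x hx => le_of_lt hx.1⟩
  · refine ⟨max (2 * c) (Real.exp ((|a - 1| * Real.log 2 + C) / (s * c))), fun x hx => ?_⟩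
    rcases le_total x (2 * c) with h2 | h2
    · exact le_max_of_le_left h2
    refine le_max_of_le_right ?_
    have hx' := (hmem x).1 hx
    have hx0 : 0 < x := hc.trans hx'.1
    rw [← Real.log_le_iff_le_exp hx0, le_div_iff₀ hsc]
    have h3 := hx'.2.2
    simp only [hh, Real.log_inv] at h3
    have hle : c * x⁻¹ ≤ 1 / 2 := by
      rw [← div_eq_mul_inv, div_le_div_iff₀ hx0 (by norm_num)]; linarith
    have hge : 0 ≤ c * x⁻¹ := by positivity
    have l1 : Real.log (1 - c * x⁻¹) ≤ 0 := Real.log_nonpos (by linarith) (by linarith)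
    have l2 : -Real.log 2 ≤ Real.log (1 - c * x⁻¹) := by
      rw [← Real.log_inv]
      exact Real.log_le_log (by norm_num) (by norm_num at *; linarith)
    have l3 : (a - 1) * Real.log (1 - c * x⁻¹) ≤ |a - 1| * Real.log 2 := by
      refine (le_abs_self _).trans ?_
      rw [abs_mul]
      refine mul_le_mul_of_nonneg_left ?_ (abs_nonneg _)
      rw [abs_of_nonpos l1]; linarith
    linarith
  · exact Filter.Eventually.of_forall fun x hx => hx.2
  · filter_upwards [Measure.ae_ne volume c] with x hx0 hx
    rcases lt_or_gt_of_ne hx0 with h0 | h0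
    · have : ¬ (0 ≤ x - c) := by linarith
      have e : gammaPDFReal a s (x - c) = 0 := by simp only [gammaPDFReal, if_neg this]
      rw [e]
      exact gammaPDFReal_nonneg hk hs x
    · by_contra! hcon
      exact hx ⟨h0, hcon.le⟩
  · rw [integral_sub_right_eq_self (μ := volume) (fun x => gammaPDFReal a s x) c,
      gp_integral ha hs, gp_integral hk hs]
  · rw [hshift, gp_x_integral hk hs]
    field_simp

lemma suff {φ : ℝ → ℝ} (hφ : ConvexOn ℝ Set.univ φ) {a b q Δ c : ℝ} (ha : 0 < a) (hb : 0 < b)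
    (hq : 0 < q) (hΔ : 0 < Δ) (hc : 0 ≤ c) (h : Δ * q ≤ 1)
    (hi : Integrable fun x => φ x * gammaPDFReal (q * (Δ * a + c * b)) (q * b) x) :
    ∫ x, φ (Δ * x + c) * gammaPDFReal a b x
      ≤ ∫ x, φ x * gammaPDFReal (q * (Δ * a + c * b)) (q * b) x := by
  have hs : 0 < q * b := by positivity
  have hsr : q * b ≤ b / Δ := by
    rw [le_div_iff₀ hΔ]; nlinarith
  have ha' : 0 < q * b * a / (b / Δ) := by positivity
  have e1 : q * (Δ * a + c * b) = q * b * a / (b / Δ) + q * b * c := by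
    field_simp
  rw [e1] at hi ⊢
  obtain ⟨i2, l2⟩ := step2 hφ ha' hs hc hi
  have hφc : ConvexOn ℝ Set.univ fun x => φ (x + c) := by
    refine ⟨convex_univ, fun x _ y _ α β hα hβ hαβ => ?_⟩
    have := hφ.2 (Set.mem_univ (x + c)) (Set.mem_univ (y + c)) hα hβ hαβ
    simp only [smul_eq_mul] at *
    have e : α * x + β * y + c = α * (x + c) + β * (y + c) := by linear_combination -c * hαβ
    rw [e]
    exact this
  have i2' : Integrable fun x => φ (x + c) * gammaPDFReal (q * b * a / (b / Δ)) (q * b) x := by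
    simpa using i2.comp_add_right c
  have l1 := (step1 hφc ha hs hsr i2').2
  have e2 := integral_sub_right_eq_self (μ := volume)
    (fun x => φ (x + c) * gammaPDFReal (q * b * a / (b / Δ)) (q * b) x) c
  simp only [sub_add_cancel] at e2
  have e3 : ∫ x, φ (Δ * x + c) * gammaPDFReal a b x
      = ∫ x, φ (x + c) * gammaPDFReal a (b / Δ) x := by
    have := Measure.integral_comp_mul_left
      (fun x => φ (x + c) * gammaPDFReal a (b / Δ) x) Δ
    simp_rw [gp_scale hb hΔ]
    have e : ∀ x, φ (Δ * x + c) * (Δ * gammaPDFReal a (b / Δ) (Δ * x))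
      = Δ * (φ (Δ * x + c) * gammaPDFReal a (b / Δ) (Δ * x)) := fun x => by ring
    simp_rw [e]
    rw [integral_const_mul, this, abs_of_pos (inv_pos.2 hΔ), smul_eq_mul,
      mul_inv_cancel_left₀ hΔ.ne']
  rw [e3]
  linarith

open MeasureTheory ProbabilityTheory

/-- **Convex-order characterization for the NB-INGARCH(1,1) evolution
(pathwise content of Theorem 5.1 of the paper).**
Let `a, b, q > 0`, `Δ ≥ 0`, `c ≥ 0` with `Δa + cb > 0`. Let `Θ ∼ Gamma(a, b)`,
`Y ∼ Gamma(q(Δa+cb), qb)` and `X = ΔΘ + c`. Then `X ⪯_cx Y` if and only if `Δq ≤ 1`. -/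
theorem stmt_10 {Ω : Type*} [mΩ : MeasurableSpace Ω] (P : Measure Ω) [IsProbabilityMeasure P]
    (a b q Δ c : ℝ) (ha : 0 < a) (hb : 0 < b) (hq : 0 < q) (hΔ : 0 ≤ Δ) (hc : 0 ≤ c)
    (hmean : 0 < Δ * a + c * b)
    (Θ Y : Ω → ℝ) (hΘmeas : Measurable Θ) (hYmeas : Measurable Y)
    (hΘ : Measure.map Θ P = gammaMeasure a b)
    (hY : Measure.map Y P = gammaMeasure (q * (Δ * a + c * b)) (q * b)) :
    (∀ φ : ℝ → ℝ, ConvexOn ℝ Set.univ φ →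
        Integrable (fun ω => φ (Δ * Θ ω + c)) P → Integrable (fun ω => φ (Y ω)) P →
        ∫ ω, φ (Δ * Θ ω + c) ∂P ≤ ∫ ω, φ (Y ω) ∂P)
    ↔ Δ * q ≤ 1 := by
  have hs : 0 < q * b := by positivity
  have hk : 0 < q * (Δ * a + c * b) := by positivity
  constructor
  · intro H
    by_contra! hcon
    have hΔ0 : 0 < Δ := by
      rcases hΔ.eq_or_lt with h | h
      · rw [← h] at hcon; norm_num at hcon
      · exact h
    have hrs : b / Δ < q * b := by
      rw [div_lt_iff₀ hΔ0]; nlinarith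
    have hr : 0 < b / Δ := by positivity
    have hbound : ∀ t, 0 < t → t < b / Δ →
        (b / (b - t * Δ)) ^ a ≤ (q * b / (q * b - b / Δ)) ^ (q * (Δ * a + c * b)) := by
      intro t ht0 ht
      have htb : t * Δ < b := by rwa [lt_div_iff₀ hΔ0] at ht
      have hconv : ConvexOn ℝ Set.univ fun x => Real.exp (t * x) := by
        refine ⟨convex_univ, fun x _ y _ α β hα hβ hαβ => ?_⟩
        have := convexOn_exp.2 (Set.mem_univ (t * x)) (Set.mem_univ (t * y)) hα hβ hαβ
        simp only [smul_eq_mul] at *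
        convert! this using 2
        ring
      have e : ∀ x, Real.exp (t * (Δ * x + c)) = Real.exp (t * c) * Real.exp (t * Δ * x) := by
        intro x; rw [← Real.exp_add]; ring_nf
      have iX0 : Integrable (fun ω => Real.exp (t * Δ * Θ ω)) P := by
        have := gp_exp_integrable ha hb htb
        rw [← hΘ] at this
        exact this.comp_measurable hΘmeas
      have iX : Integrable (fun ω => Real.exp (t * (Δ * Θ ω + c))) P := by
        simp_rw [e]
        exact iX0.const_mul _
      have iY : Integrable (fun ω => Real.exp (t * Y ω)) P := by
        have := gp_exp_integrable hk hs (ht.trans hrs)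
        rw [← hY] at this
        exact this.comp_measurable hYmeas
      have h1 := H _ hconv iX iY
      have eX : ∫ ω, Real.exp (t * Δ * Θ ω) ∂P = (b / (b - t * Δ)) ^ a := by
        rw [← gp_exp_integral ha hb htb, ← hΘ, integral_map hΘmeas.aemeasurable]
        exact Continuous.aestronglyMeasurable (by fun_prop)
      have eY : ∫ ω, Real.exp (t * Y ω) ∂P
          = (q * b / (q * b - t)) ^ (q * (Δ * a + c * b)) := by
        rw [← gp_exp_integral hk hs (ht.trans hrs), ← hY, integral_map hYmeas.aemeasurable]
        exact Continuous.aestronglyMeasurable (by fun_prop)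
      simp_rw [e] at h1
      rw [integral_const_mul, eX, eY] at h1
      have hp : 0 ≤ (b / (b - t * Δ)) ^ a := 
        Real.rpow_nonneg (div_nonneg hb.le (by linarith)) _
      have h2 : 1 ≤ Real.exp (t * c) := Real.one_le_exp (by positivity)
      have h3 : (q * b / (q * b - t)) ^ (q * (Δ * a + c * b))
          ≤ (q * b / (q * b - b / Δ)) ^ (q * (Δ * a + c * b)) := by
        refine Real.rpow_le_rpow (div_nonneg hs.le (by linarith)) ?_ hk.le
        exact div_le_div_of_nonneg_left hs.le (by linarith) (by linarith)
      nlinarith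
    set K := (q * b / (q * b - b / Δ)) ^ (q * (Δ * a + c * b)) with hK
    have hK0 : 0 < K := Real.rpow_pos_of_pos (div_pos hs (by linarith)) _
    -- choose t with b / (b - t Δ) = N
    set N := (K + 1) ^ (1 / a) with hN
    have hN1 : 1 < N := Real.one_lt_rpow (by linarith) (by positivity)
    have hN0 : 0 < N := by linarith
    have hNinv : N⁻¹ < 1 := inv_lt_one_of_one_lt₀ hN1
    have hNinv0 : 0 < N⁻¹ := by positivity
    have h1 := hbound (b / Δ * (1 - N⁻¹)) (mul_pos hr (by linarith)) (by nlinarith)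
    have e : b / (b - b / Δ * (1 - N⁻¹) * Δ) = N := by
      have : b - b / Δ * (1 - N⁻¹) * Δ = b / N := by field_simp; ring
      rw [this]; field_simp
    rw [e, hN, ← Real.rpow_mul (by linarith), one_div_mul_cancel ha.ne', Real.rpow_one] at h1
    linarith
  · intro h φ hφ iX iY
    have hcont : Continuous φ := by
      rw [← continuousOn_univ]; exact hφ.continuousOn isOpen_univ
    have iY' : Integrable φ (gammaMeasure (q * (Δ * a + c * b)) (q * b)) := by
      rw [← hY, integrable_map_measure hcont.aestronglyMeasurable hYmeas.aemeasurable]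
      exact iY
    have eY : ∫ ω, φ (Y ω) ∂P = ∫ x, φ x ∂(gammaMeasure (q * (Δ * a + c * b)) (q * b)) := by
      rw [← hY, integral_map hYmeas.aemeasurable hcont.aestronglyMeasurable]
    rcases hΔ.eq_or_lt with h0 | h0
    · subst h0
      have : IsProbabilityMeasure (gammaMeasure (q * (0 * a + c * b)) (q * b)) :=
        isProbabilityMeasure_gammaMeasure hk hs
      have hx : Integrable (fun x : ℝ => x) (gammaMeasure (q * (0 * a + c * b)) (q * b)) :=
        (gm_integrable_iff hk hs _).2 (gp_x_integrable hk hs)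
      have hJ := hφ.map_integral_le hcont.continuousOn isClosed_univ
        (Filter.Eventually.of_forall fun x => Set.mem_univ _) hx iY'
      rw [gm_integral hk hs, gp_x_integral hk hs] at hJ
      have e : q * (0 * a + c * b) / (q * b) = c := by field_simp; ring
      rw [e] at hJ
      rw [eY]
      simpa using hJ
    · have eX : ∫ ω, φ (Δ * Θ ω + c) ∂P = ∫ x, φ (Δ * x + c) ∂(gammaMeasure a b) := by
        rw [← hΘ, integral_map hΘmeas.aemeasurable
          (Continuous.aestronglyMeasurable (by fun_prop))]
      rw [eX, eY, gm_integral ha hb, gm_integral hk hs]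
      exact suff hφ ha hb hq h0 hc h ((gm_integrable_iff hk hs _).1 iY')
end
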